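/- arXiv:1710.01908 — 2 statements merged into one kernel-verified Lean document; each statement's English description precedes it below -/
import Mathlib

section
/- Let (A, I) be a henselian pair, S = Spec(A), S₀ = Spec(A/I), f : X → S a proper morphism of finite presentation, and X₀ = X ×_S S₀. Then X is nonempty and connected if and only if X₀ is nonempty and connected. -/
open CategoryTheory AlgebraicGeometry MorphismProperty Limits

universe u

namespace HensConn

section RZ
variable {K : Type*} [Field K]

/-- valuation subrings containing `M` with `J` in the maximal ideal. -/
def RZ (M : Subring K) (J : Set K) : Set (ValuationSubring K) :=
  {W | (∀ b ∈ M, b ∈ W) ∧ ∀ b ∈ J, b ∈ W.nonunits}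

/-- locally constant predicates -/
def LC (Z : Set (ValuationSubring K)) (U : ValuationSubring K → Prop) : Prop :=
  ∀ W ∈ Z, ∃ S : Finset K, (∀ s ∈ S, s ∈ W) ∧ ∀ W' ∈ Z, (∀ s ∈ S, s ∈ W') → (U W' ↔ U W)

lemma LC.mono {Z Z' : Set (ValuationSubring K)} {U} (h : LC Z U) (hZ : Z' ⊆ Z) : LC Z' U := by
  intro W hW
  obtain ⟨S, h1, h2⟩ := h W (hZ hW)
  exact ⟨S, h1, fun W' hW' => h2 W' (hZ hW')⟩

lemma nonunits_mul {W : ValuationSubring K} {a b : K} (ha : a ∈ W) (hb : b ∈ W.nonunits) :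
    a * b ∈ W.nonunits := by
  rw [ValuationSubring.mem_nonunits_iff] at *
  rw [← ValuationSubring.valuation_le_one_iff] at ha
  rw [map_mul]
  exact mul_lt_one_of_nonneg_of_lt_one_right ha zero_le hb

lemma one_notMem_nonunits {W : ValuationSubring K} : (1 : K) ∉ W.nonunits := by
  rw [ValuationSubring.mem_nonunits_iff]; simp

lemma exists_RZ {M : Subring K} (J : Set K) (hJ : J ⊆ M)
    (h : Ideal.span ((Subtype.val : M → K) ⁻¹' J) ≠ ⊤) : ∃ W, W ∈ RZ M J := by
  obtain ⟨W, h1, h2⟩ := Ideal.image_subset_nonunits_valuationSubring _ h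
  exact ⟨W, fun b hb => h1 hb, fun b hb => h2 ⟨⟨b, hJ hb⟩, Ideal.subset_span hb, rfl⟩⟩

/-- ultrafilter limit -/
def ulim {ι : Type*} (F : Ultrafilter ι) (w : ι → ValuationSubring K) : ValuationSubring K where
  carrier := {x | ∀ᶠ i in F, x ∈ w i}
  mul_mem' ha hb := by
    filter_upwards [ha, hb] with i h1 h2 using mul_mem h1 h2
  one_mem' := Filter.Eventually.of_forall fun i => one_mem _
  add_mem' ha hb := by
    filter_upwards [ha, hb] with i h1 h2 using add_mem h1 h2
  zero_mem' := Filter.Eventually.of_forall fun i => zero_mem _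
  neg_mem' ha := by
    filter_upwards [ha] with i h1 using neg_mem h1
  mem_or_inv_mem' x := by
    show (∀ᶠ i in F, x ∈ w i) ∨ (∀ᶠ i in F, x⁻¹ ∈ w i)
    rw [← Ultrafilter.eventually_or]
    exact Filter.Eventually.of_forall fun i => (w i).mem_or_inv_mem x

lemma mem_ulim {ι : Type*} {F : Ultrafilter ι} {w : ι → ValuationSubring K} {x : K} :
    x ∈ ulim F w ↔ ∀ᶠ i in F, x ∈ w i := Iff.rfl

lemma nonunits_ulim {ι : Type*} {F : Ultrafilter ι} {w : ι → ValuationSubring K} {x : K} :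
    x ∈ (ulim F w).nonunits ↔ ∀ᶠ i in F, x ∈ (w i).nonunits := by
  simp only [ValuationSubring.mem_nonunits_iff_or, mem_ulim]
  rw [← Ultrafilter.eventually_not, Ultrafilter.eventually_or]
  simp

lemma ulim_RZ {ι : Type*} {F : Ultrafilter ι} {w : ι → ValuationSubring K} {M : Subring K}
    {J : Set K} (h : ∀ i, w i ∈ RZ M J) : ulim F w ∈ RZ M J :=
  ⟨fun b hb => mem_ulim.2 (Filter.Eventually.of_forall fun i => (h i).1 b hb),
   fun b hb => nonunits_ulim.2 (Filter.Eventually.of_forall fun i => (h i).2 b hb)⟩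

lemma LC.ulim {ι : Type*} {F : Ultrafilter ι} {w : ι → ValuationSubring K} {M : Subring K}
    {J : Set K} {U} (hU : LC (RZ M J) U) (h : ∀ i, w i ∈ RZ M J) :
    ∀ᶠ i in F, (U (w i) ↔ U (ulim F w)) := by
  obtain ⟨S, h1, h2⟩ := hU _ (ulim_RZ (F := F) h)
  have : ∀ᶠ i in F, ∀ s ∈ S, s ∈ w i := by
    rw [Filter.eventually_all_finset]
    exact h1
  filter_upwards [this] with i hi using h2 _ (h i) hi

/-- Specialization -/
lemma exists_specialize {M : Subring K} {W : ValuationSubring K} (hW : ∀ b ∈ M, b ∈ W)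
    (Q : Ideal M) (hQ1 : Q ≠ ⊤) (hQ : ∀ b : M, (b : K) ∈ W.nonunits → b ∈ Q) :
    ∃ W' ≤ W, W' ∈ RZ M (Subtype.val '' (Q : Set M)) := by
  let T : Subring K :=
    { carrier := {x | ∃ a ∈ M, x - a ∈ W.nonunits}
      mul_mem' := by
        rintro x y ⟨a, ha, hx⟩ ⟨b, hb, hy⟩
        refine ⟨a * b, mul_mem ha hb, ?_⟩
        have hxW : x ∈ W := by
          have := W.add_mem _ _ (ValuationSubring.nonunits_le hx) (hW a ha)
          simpa using this
        have : x * y - a * b = x * (y - b) + b * (x - a) := by ring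
        rw [this]
        exact add_mem (nonunits_mul hxW hy) (nonunits_mul (hW b hb) hx)
      one_mem' := ⟨1, one_mem _, by simpa using W.nonunits.zero_mem⟩
      add_mem' := by
        rintro x y ⟨a, ha, hx⟩ ⟨b, hb, hy⟩
        refine ⟨a + b, add_mem ha hb, ?_⟩
        rw [add_sub_add_comm]; exact add_mem hx hy
      zero_mem' := ⟨0, zero_mem _, by simpa using W.nonunits.zero_mem⟩
      neg_mem' := by
        rintro x ⟨a, ha, hx⟩
        refine ⟨-a, neg_mem ha, ?_⟩
        rw [← neg_sub', ]; exact neg_mem hx }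
  let N : Ideal T :=
    { carrier := {x | ∃ a ∈ Q, (x : K) - a ∈ W.nonunits}
      add_mem' := by
        rintro x y ⟨a, ha, hx⟩ ⟨b, hb, hy⟩
        refine ⟨a + b, add_mem ha hb, ?_⟩
        push_cast
        rw [add_sub_add_comm]; exact add_mem hx hy
      zero_mem' := ⟨0, zero_mem _, by simpa using W.nonunits.zero_mem⟩
      smul_mem' := by
        rintro ⟨x, a, ha, hx⟩ y ⟨b, hb, hy⟩
        refine ⟨⟨a, ha⟩ * b, Ideal.mul_mem_left _ _ hb, ?_⟩
        have hxW : x ∈ W := by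
          have := W.add_mem _ _ (ValuationSubring.nonunits_le hx) (hW a ha)
          simpa using this
        have : x * y - a * b = x * (y - b) + b * (x - a) := by ring
        simp only [smul_eq_mul, Subring.coe_mul]
        rw [this]
        exact add_mem (nonunits_mul hxW hy) (nonunits_mul (hW b b.2) hx) }
  have hN : N ≠ ⊤ := by
    rw [Ideal.ne_top_iff_one]
    rintro ⟨a, ha, h⟩
    apply hQ1
    rw [Ideal.eq_top_iff_one]
    have := Q.add_mem (hQ (1 - a) (by simpa using h)) ha
    simpa using this
  obtain ⟨W', h1, h2⟩ := Ideal.image_subset_nonunits_valuationSubring _ hN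
  refine ⟨W', ?_, fun b hb => h1 ⟨b, hb, by simpa using W.nonunits.zero_mem⟩, ?_⟩
  · rw [← ValuationSubring.nonunits_le_nonunits]
    intro x hx
    exact h2 ⟨⟨x, 0, zero_mem _, by simpa using hx⟩, ⟨0, zero_mem _, by simpa using hx⟩, rfl⟩
  · rintro _ ⟨b, hb, rfl⟩
    exact h2 ⟨⟨b, b, b.2, by simpa using W.nonunits.zero_mem⟩,
      ⟨b, hb, by simpa using W.nonunits.zero_mem⟩, rfl⟩

/-- one half of separation -/
lemma exists_center {M : Subring K} {J : Set K} {U : ValuationSubring K → Prop}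
    (hU : LC (RZ M J) U) (b : Prop) (Q : Ideal M) (hQ : Q.IsMaximal)
    (h : ∀ g : M, (∀ W ∈ RZ M J, (U W ↔ b) → (g : K) ∈ W.nonunits) → g ∈ Q) :
    ∃ W ∈ RZ M J, (U W ↔ b) ∧ W ∈ RZ M (Subtype.val '' (Q : Set M)) := by
  have key : ∀ g : M, g ∉ Q → ∃ W ∈ RZ M J, (U W ↔ b) ∧ (g : K) ∉ W.nonunits := by
    intro g hg
    by_contra! hcon
    exact hg (h g hcon)
  let ι := {W : ValuationSubring K // W ∈ RZ M J ∧ (U W ↔ b)}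
  let w : ι → ValuationSubring K := Subtype.val
  let B : {g : M // g ∉ Q} → Set ι := fun g => {W | ((g : M) : K) ∉ (w W).nonunits}
  have hne : Nonempty {g : M // g ∉ Q} := ⟨⟨1, (Ideal.ne_top_iff_one Q).1 hQ.ne_top⟩⟩
  have hdir : Directed (· ≥ ·) (fun g => Filter.principal (B g)) := by
    rintro ⟨g1, h1⟩ ⟨g2, h2⟩
    refine ⟨⟨g1 * g2, fun hh => ?_⟩, ?_, ?_⟩
    · exact (hQ.isPrime.mem_or_mem hh).elim h1 h2
    · simp only [ge_iff_le, Filter.le_principal_iff, Filter.mem_principal]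
      intro W hW hc
      apply hW
      have := nonunits_mul (W.2.1.1 _ g2.2) hc
      rw [mul_comm] at this
      simpa using this
    · simp only [ge_iff_le, Filter.le_principal_iff, Filter.mem_principal]
      intro W hW hc
      apply hW
      have := nonunits_mul (W.2.1.1 _ g1.2) hc
      simpa using this
  have : (⨅ g, Filter.principal (B g)).NeBot := by
    have : Nonempty ι := by
      obtain ⟨W, h1, h2, h3⟩ := key 1 ((Ideal.ne_top_iff_one Q).1 hQ.ne_top)
      exact ⟨⟨W, h1, h2⟩⟩
    rw [Filter.iInf_neBot_iff_of_directed hdir]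
    rintro ⟨g, hg⟩
    rw [Filter.principal_neBot_iff]
    obtain ⟨W, h1, h2, h3⟩ := key g hg
    exact ⟨⟨W, h1, h2⟩, h3⟩
  let F := Ultrafilter.of (⨅ g, Filter.principal (B g))
  have hF : ∀ g : M, g ∉ Q → ∀ᶠ W in F, (g : K) ∉ (w W).nonunits := by
    intro g hg
    have : B ⟨g, hg⟩ ∈ (⨅ g, Filter.principal (B g)) :=
      Filter.mem_iInf_of_mem ⟨g, hg⟩ (Filter.mem_principal_self _)
    exact Ultrafilter.of_le _ this
  have hRZ : ulim F w ∈ RZ M J := ulim_RZ fun i => i.2.1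
  have hUl : U (ulim F w) ↔ b := by
    obtain ⟨i, hi⟩ := (hU.ulim (F := F) (w := w) fun i => i.2.1).exists
    rw [← hi]; exact i.2.2
  obtain ⟨W', hle, hW'⟩ := exists_specialize (W := ulim F w) hRZ.1 Q hQ.ne_top (by
    intro g hg
    by_contra hgQ
    have h1 := nonunits_ulim.1 hg
    obtain ⟨i, hi1, hi2⟩ := (h1.and (hF g hgQ)).exists
    exact hi2 hi1)
  have hW'J : W' ∈ RZ M J := ⟨hW'.1, fun b hb =>
    (ValuationSubring.nonunits_le_nonunits.2 hle) (hRZ.2 b hb)⟩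
  refine ⟨W', hW'J, ?_, hW'⟩
  obtain ⟨S, h1, h2⟩ := hU W' hW'J
  rw [← h2 _ hRZ fun s hs => hle (h1 s hs)]
  exact hUl

lemma exists_sep {M : Subring K} {J : Set K} {U : ValuationSubring K → Prop}
    (hU : LC (RZ M J) U)
    (hc : ∀ Q : Ideal M, Q.IsMaximal → (∀ b : M, (b : K) ∈ J → b ∈ Q) →
      ∀ W ∈ RZ M (Subtype.val '' (Q : Set M)), ∀ W' ∈ RZ M (Subtype.val '' (Q : Set M)),
        U W → U W') :
    ∃ e ∈ M, ∀ W ∈ RZ M J, (U W → e ∈ W.nonunits) ∧ (¬ U W → 1 - e ∈ W.nonunits) := by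
  let a (b : Prop) : Ideal M :=
    { carrier := {g | ∀ W ∈ RZ M J, (U W ↔ b) → (g : K) ∈ W.nonunits}
      add_mem' := fun hx hy W h1 h2 => add_mem (hx W h1 h2) (hy W h1 h2)
      zero_mem' := fun W h1 h2 => W.nonunits.zero_mem
      smul_mem' := fun c x hx W h1 h2 => nonunits_mul (h1.1 c c.2) (hx W h1 h2) }
  by_cases htop : a True ⊔ a False = ⊤
  · rw [Ideal.eq_top_iff_one, Submodule.mem_sup] at htop
    obtain ⟨y, hy, z, hz, hyz⟩ := htop
    refine ⟨y, y.2, fun W hW => ⟨fun h => hy W hW (by simpa using h), fun h => ?_⟩⟩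
    have : (1 : K) - y = z := by
      rw [sub_eq_iff_eq_add']; exact_mod_cast hyz.symm
    rw [this]
    exact hz W hW (by simpa using h)
  · obtain ⟨Q, hQ, hle⟩ := Ideal.exists_le_maximal _ htop
    obtain ⟨W1, h1, h1U, h1Q⟩ := exists_center hU True Q hQ fun g hg => hle
      ((le_sup_left : a True ≤ _) hg)
    obtain ⟨W2, h2, h2U, h2Q⟩ := exists_center hU False Q hQ fun g hg => hle
      ((le_sup_right : a False ≤ _) hg)
    have hJ : ∀ b : M, (b : K) ∈ J → b ∈ Q := fun b hb =>
      hle ((le_sup_left : a True ≤ _) fun W hW _ => hW.2 b hb)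
    exact absurd (hc Q hQ hJ W1 h1Q W2 h2Q (h1U.2 trivial)) (fun h => h2U.1 h)

lemma exists_finite_det {M : Subring K} {J : Set K} {U : ValuationSubring K → Prop}
    (hU : LC (RZ M J) U) : ∃ F : Finset K, ∀ W ∈ RZ M J, ∀ W' ∈ RZ M J,
      (∀ f ∈ F, (f ∈ W ↔ f ∈ W')) → U W → U W' := by
  classical
  by_contra! hcon
  choose w hw w' hw' hww hUw hUw' using hcon
  let F : Ultrafilter (Finset K) := Ultrafilter.of Filter.atTop
  have heq : ulim F w = ulim F w' := by
    ext x
    rw [mem_ulim, mem_ulim]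
    apply Filter.eventually_congr
    have : ∀ᶠ S : Finset K in Filter.atTop, x ∈ S := by
      filter_upwards [Filter.eventually_ge_atTop {x}] with S hS
      exact hS (Finset.mem_singleton_self x)
    filter_upwards [Ultrafilter.of_le _ this] with S hS using hww S x hS
  obtain ⟨i, hi, hi'⟩ := ((hU.ulim (F := F) hw).and (hU.ulim (F := F) hw')).exists
  rw [heq] at hi
  exact hUw' i (hi'.2 (hi.1 (hUw i)))

lemma exists_exact {M : Subring K} (P : Ideal M) (hP : P.IsPrime) :
    ∃ W : ValuationSubring K, (∀ b ∈ M, b ∈ W) ∧ ∀ b : M, (b : K) ∈ W.nonunits ↔ b ∈ P := by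
  obtain ⟨W, h1, h2⟩ := (LocalSubring.ofPrime M P).exists_le_valuationSubring
  have hMW : ∀ b ∈ M, b ∈ W := fun b hb => h1 (LocalSubring.le_ofPrime M P hb)
  refine ⟨W, hMW, fun b => ?_⟩
  have e1 := IsLocalization.AtPrime.to_map_mem_maximal_iff (LocalSubring.ofPrime M P).toSubring P b
  rw [← e1, IsLocalRing.mem_maximalIdeal, mem_nonunits_iff]
  have e2 : (b : K) ∈ W.nonunits ↔ (⟨b, hMW b b.2⟩ : W) ∈ IsLocalRing.maximalIdeal W :=
    ValuationSubring.coe_mem_nonunits_iff (a := (⟨b, hMW b b.2⟩ : W))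
  rw [e2, IsLocalRing.mem_maximalIdeal, mem_nonunits_iff, not_iff_not]
  exact isUnit_map_iff (Subring.inclusion h1) (algebraMap M (LocalSubring.ofPrime M P).toSubring b)

lemma mem_radical {M : Subring K} {J : Set K} (hJ : J ⊆ M) {g : K} (hg : g ∈ M)
    (h : ∀ W ∈ RZ M J, g ∈ W.nonunits) :
    (⟨g, hg⟩ : M) ∈ (Ideal.span ((Subtype.val : M → K) ⁻¹' J)).radical := by
  rw [Ideal.radical_eq_sInf, Ideal.mem_sInf]
  rintro P ⟨hPJ, hP⟩
  by_contra hgP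
  obtain ⟨W, hMW, hnu⟩ := exists_exact P hP
  refine hgP ((hnu ⟨g, hg⟩).1 (h W ⟨hMW, fun b hb => ?_⟩))
  exact (hnu ⟨b, hJ hb⟩).2 (hPJ (Ideal.subset_span hb))

end RZ
end HensConn

namespace HensConn

section D0

/-- the idempotent-improving iteration -/
def gI {R : Type*} [CommRing R] (x : R) : R := 3 * x ^ 2 - 2 * x ^ 3

lemma gI_mul {R : Type*} [CommRing R] (x : R) :
    gI x * (1 - gI x) = (x * (1 - x)) * (x * (1 - x)) * ((3 - 2 * x) * (1 + 2 * x)) := by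
  unfold gI; ring

lemma gI_sub_self {R : Type*} [CommRing R] (x : R) :
    gI x - x = x * (1 - x) * (2 * x - 1) := by
  unfold gI; ring

lemma gI_sub {R : Type*} [CommRing R] (x y : R) :
    gI x - gI y = y * (1 - y) * (x - y) * 6 + (x - y) * (x - y) * ((3 - 6 * y) - 2 * (x - y)) := by
  unfold gI; ring

variable {C K : Type*} [CommRing C] [CommRing K] [Algebra C K]

lemma smul_sub_mul_mem (n : Ideal C) (P : Subalgebra C K) (i j : ℕ) {a b : K}
    (ha : a ∈ n ^ i • Subalgebra.toSubmodule P) (hb : b ∈ n ^ j • Subalgebra.toSubmodule P) :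
    a * b ∈ n ^ (i + j) • Subalgebra.toSubmodule P := by
  refine Submodule.smul_induction_on ha (fun r hr p hp => ?_) (fun a a' h h' => ?_)
  · refine Submodule.smul_induction_on hb (fun r' hr' p' hp' => ?_) (fun a a' h h' => ?_)
    · rw [smul_mul_smul_comm, pow_add]
      exact Submodule.smul_mem_smul (Ideal.mul_mem_mul hr hr') (P.mul_mem hp hp')
    · rw [mul_add]; exact add_mem h h'
  · rw [add_mul]; exact add_mem h h'

lemma smul_sub_mul_mem' (n : Ideal C) (P : Subalgebra C K) (i : ℕ) {a b : K}
    (ha : a ∈ n ^ i • Subalgebra.toSubmodule P) (hb : b ∈ P) :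
    a * b ∈ n ^ i • Subalgebra.toSubmodule P :=
  smul_sub_mul_mem n P i 0 ha (by simpa using hb)

lemma smul_sub_mono (n : Ideal C) (P : Subalgebra C K) {i j : ℕ} (h : i ≤ j) :
    n ^ j • Subalgebra.toSubmodule P ≤ n ^ i • Subalgebra.toSubmodule P :=
  Submodule.smul_mono_left (Ideal.pow_le_pow_right h)

lemma gI_mem {P : Subalgebra C K} {x : K} (hx : x ∈ P) : gI x ∈ P := by
  have := (gI (⟨x, hx⟩ : P)).2
  exact this

lemma iter_mem {P : Subalgebra C K} {x : K} (hx : x ∈ P) (k : ℕ) : gI^[k] x ∈ P := by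
  induction k with
  | zero => exact hx
  | succ k ih => rw [Function.iterate_succ_apply']; exact gI_mem ih

lemma iter_idem (n : Ideal C) {P : Subalgebra C K} {x : K} (hx : x ∈ P)
    (h : x * (1 - x) ∈ n • Subalgebra.toSubmodule P) (k : ℕ) :
    gI^[k] x * (1 - gI^[k] x) ∈ n ^ (k + 1) • Subalgebra.toSubmodule P := by
  induction k with
  | zero => simpa using h
  | succ k ih =>
    rw [Function.iterate_succ_apply', gI_mul]
    have hp : (3 - 2 * gI^[k] x) * (1 + 2 * gI^[k] x) ∈ P := by
      have := ((3 - 2 * (⟨_, iter_mem hx k⟩ : P)) * (1 + 2 * (⟨_, iter_mem hx k⟩ : P))).2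
      exact this
    exact smul_sub_mono n P (by omega)
      (smul_sub_mul_mem' n P _ (smul_sub_mul_mem n P _ _ ih ih) hp)

lemma iter_sub (n : Ideal C) {P : Subalgebra C K} {x : K} (hx : x ∈ P)
    (h : x * (1 - x) ∈ n • Subalgebra.toSubmodule P) (k : ℕ) :
    gI^[k] x - x ∈ n • Subalgebra.toSubmodule P := by
  induction k with
  | zero => simp
  | succ k ih =>
    have e : gI^[k+1] x - x = (gI (gI^[k] x) - gI^[k] x) + (gI^[k] x - x) := by
      rw [Function.iterate_succ_apply']; ring
    rw [e, gI_sub_self]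
    refine add_mem ?_ ih
    have hp : (2 * gI^[k] x - 1) ∈ P := by
      have := (2 * (⟨_, iter_mem hx k⟩ : P) - 1).2
      exact this
    have := smul_sub_mono n P (i := 1) (by omega)
      (smul_sub_mul_mem' n P _ (iter_idem n hx h k) hp)
    simpa using this

lemma iter_diff (n : Ideal C) {P : Subalgebra C K} {x y : K} (hx : x ∈ P) (hy : y ∈ P)
    (h : y * (1 - y) ∈ n • Subalgebra.toSubmodule P)
    (hxy : x - y ∈ n • Subalgebra.toSubmodule P) (k : ℕ) :
    gI^[k] x - gI^[k] y ∈ n ^ (k + 1) • Subalgebra.toSubmodule P := by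
  induction k with
  | zero => simpa using hxy
  | succ k ih =>
    rw [Function.iterate_succ_apply', Function.iterate_succ_apply', gI_sub]
    refine add_mem ?_ ?_
    · exact smul_sub_mono n P (by omega) (smul_sub_mul_mem' n P _ (smul_sub_mul_mem n P _ _
        (iter_idem n hy h k) ih) (by exact (6 : P).2))
    · have hp : ((3 - 6 * gI^[k] y) - 2 * (gI^[k] x - gI^[k] y)) ∈ P := by
        have := ((3 - 6 * (⟨_, iter_mem hy k⟩ : P)) -
          2 * ((⟨_, iter_mem hx k⟩ : P) - (⟨_, iter_mem hy k⟩ : P))).2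
        exact this
      exact smul_sub_mono n P (by omega)
        (smul_sub_mul_mem' n P _ (smul_sub_mul_mem n P _ _ ih ih) hp)

lemma core [IsNoetherianRing C] (n : Ideal C) (P Q R : Subalgebra C K) (hPR : P ≤ R) (hQR : Q ≤ R)
    {x y : K} (hx : x ∈ P) (hy : y ∈ Q)
    (hx1 : x * (1 - x) ∈ n • Subalgebra.toSubmodule P)
    (hy1 : y * (1 - y) ∈ n • Subalgebra.toSubmodule Q)
    (hxy : x - y ∈ n • Subalgebra.toSubmodule R)
    (E : Submodule C K) (hE : E.FG)
    (hER : n • Subalgebra.toSubmodule R ≤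
      E ⊔ (n • Subalgebra.toSubmodule P ⊔ n • Subalgebra.toSubmodule Q)) :
    ∃ c, c ∈ P ∧ c ∈ Q ∧ ∃ r ∈ n, c - (1 - algebraMap C K r) * x ∈ n • Subalgebra.toSubmodule P ∧
      c - (1 - algebraMap C K r) * y ∈ n • Subalgebra.toSubmodule Q := by
  let D := n • Subalgebra.toSubmodule P ⊔ n • Subalgebra.toSubmodule Q
  let H : Submodule C (K ⧸ D) := (n • Subalgebra.toSubmodule R).map D.mkQ
  have hHE : H ≤ E.map D.mkQ := by
    refine (Submodule.map_mono hER).trans ?_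
    rw [Submodule.map_sup, show Submodule.map D.mkQ (n • Subalgebra.toSubmodule P ⊔ n • Subalgebra.toSubmodule Q) = ⊥ from Submodule.mkQ_map_self D, sup_bot_eq]
  have hHfg : Module.Finite C H := by
    have : Module.Finite C (E.map D.mkQ) := Module.Finite.iff_fg.2 (hE.map _)
    have : IsNoetherian C (E.map D.mkQ) := isNoetherian_of_isNoetherianRing_of_finite C _
    have := isNoetherian_of_le hHE
    infer_instance
  have hyR : y * (1 - y) ∈ n • Subalgebra.toSubmodule R :=
    smul_mono_right n (show Subalgebra.toSubmodule Q ≤ Subalgebra.toSubmodule R from hQR) hy1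
  have hδ : D.mkQ (x - y) ∈ H := Submodule.mem_map_of_mem hxy
  have hall : (⟨_, hδ⟩ : H) ∈ (⨅ i : ℕ, n ^ i • (⊤ : Submodule C H)) := by
    rw [Submodule.mem_iInf]
    intro k
    have h1 := iter_diff n (hPR hx) (hQR hy) hyR hxy k
    rw [pow_succ, mul_smul] at h1
    have h2 := Submodule.mem_map_of_mem (f := D.mkQ) h1
    have h3 : D.mkQ (x - y) = D.mkQ (gI^[k] x - gI^[k] y) := by
      rw [← sub_eq_zero, ← map_sub]
      simp only [Submodule.mkQ_apply, Submodule.Quotient.mk_eq_zero]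
      have : x - y - (gI^[k] x - gI^[k] y) = -(gI^[k] x - x) + (gI^[k] y - y) := by ring
      rw [this]
      exact Submodule.add_mem_sup (neg_mem (iter_sub n hx hx1 k)) (iter_sub n hy hy1 k)
    rw [← h3, Submodule.map_smul''] at h2
    have h4 : (n ^ k • (⊤ : Submodule C H)).map H.subtype = n ^ k • H := by
      rw [Submodule.map_smul'', Submodule.map_subtype_top]
    change D.mkQ (x - y) ∈ n ^ k • H at h2
    rw [← h4, Submodule.mem_map] at h2
    obtain ⟨z, hz, hz'⟩ := h2
    have hz2 : z = ⟨D.mkQ (x - y), hδ⟩ := Subtype.ext hz'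
    rwa [← hz2]
  rw [Ideal.mem_iInf_smul_pow_eq_bot_iff] at hall
  obtain ⟨⟨r, hr⟩, hr1⟩ := hall
  have h5 : r • D.mkQ (x - y) = D.mkQ (x - y) := congrArg Subtype.val hr1
  have h6 : (x - y) - r • (x - y) ∈ D := by
    rw [← Submodule.Quotient.mk_eq_zero, ← Submodule.mkQ_apply, map_sub, map_smul, h5, sub_self]
  obtain ⟨p, hp, q, hq, hpq⟩ := Submodule.mem_sup.1 h6
  have hpP : p ∈ P := (Submodule.smul_le_right : _ ≤ Subalgebra.toSubmodule P) hp
  have hqQ : q ∈ Q := (Submodule.smul_le_right : _ ≤ Subalgebra.toSubmodule Q) hq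
  have e : (1 - algebraMap C K r) * x - p = (1 - algebraMap C K r) * y + q := by
    rw [Algebra.smul_def] at hpq
    linear_combination -hpq
  refine ⟨(1 - algebraMap C K r) * x - p, ?_, ?_, r, hr, ?_, ?_⟩
  · exact sub_mem (mul_mem (sub_mem (one_mem _) (P.algebraMap_mem r)) hx) hpP
  · rw [e]
    exact add_mem (mul_mem (sub_mem (one_mem _) (Q.algebraMap_mem r)) hy) hqQ
  · simpa using neg_mem hp
  · rw [e]; simpa using hq

end D0
end HensConn

namespace HensConn

section iter

lemma iter_rad {R : Type*} [CommRing R] (a : Ideal R) (x : R) (h : x * (1 - x) ∈ a.radical) :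
    ∃ j0, ∀ j ≥ j0, gI^[j] x * (1 - gI^[j] x) ∈ a := by
  have hfg : (Ideal.span {x * (1 - x)}).FG := ⟨{x * (1 - x)}, by simp⟩
  obtain ⟨N, hN⟩ := Ideal.exists_pow_le_of_le_radical_of_fg (I := Ideal.span {x * (1 - x)}) (J := a)
    ((Ideal.span_singleton_le_iff_mem _).2 h) hfg
  refine ⟨N, fun j hj => ?_⟩
  have := iter_idem (C := R) (Ideal.span {x * (1 - x)}) (P := ⊤) (x := x) trivial
    (by simpa using Ideal.subset_span rfl) j
  simp only [Algebra.top_toSubmodule, smul_eq_mul, Ideal.mul_top] at this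
  exact hN (Ideal.pow_le_pow_right (by omega) this)

lemma iter_rad_diff {R : Type*} [CommRing R] (a : Ideal R) (x y : R)
    (h : y * (1 - y) ∈ a.radical) (h' : x - y ∈ a.radical) :
    ∃ j0, ∀ j ≥ j0, gI^[j] x - gI^[j] y ∈ a := by
  have hfg : (Ideal.span {y * (1 - y), x - y}).FG := Submodule.fg_span (by simp)
  obtain ⟨N, hN⟩ := Ideal.exists_pow_le_of_le_radical_of_fg
    (I := Ideal.span {y * (1 - y), x - y}) (J := a)
    (Ideal.span_le.2 (by rintro _ (rfl | rfl) <;> assumption)) hfg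
  refine ⟨N, fun j hj => ?_⟩
  have := iter_diff (C := R) (Ideal.span {y * (1 - y), x - y}) (P := ⊤) (x := x) (y := y)
    trivial trivial
    (by simpa using Ideal.subset_span (by simp)) (by simpa using Ideal.subset_span (by simp)) j
  simp only [Algebra.top_toSubmodule, smul_eq_mul, Ideal.mul_top] at this
  exact hN (Ideal.pow_le_pow_right (by omega) this)

end iter

section D
variable {K : Type*} [Field K]

/-- integral closure of `B[s]` -/
def ic (B : Subring K) (s : Set K) : Subring K where
  carrier := {x | ∀ W : ValuationSubring K, (∀ b ∈ B, b ∈ W) → (∀ f ∈ s, f ∈ W) → x ∈ W}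
  mul_mem' ha hb W h h' := mul_mem (ha W h h') (hb W h h')
  one_mem' W _ _ := one_mem W
  add_mem' ha hb W h h' := add_mem (ha W h h') (hb W h h')
  zero_mem' W _ _ := zero_mem W
  neg_mem' ha W h h' := neg_mem (ha W h h')

lemma mem_ic {B : Subring K} {s : Set K} {x : K} : x ∈ ic B s ↔
    ∀ W : ValuationSubring K, (∀ b ∈ B, b ∈ W) → (∀ f ∈ s, f ∈ W) → x ∈ W := Iff.rfl

lemma le_ic {B : Subring K} {s : Set K} : B ≤ ic B s := fun b hb W h _ => h b hb

lemma subset_ic {B : Subring K} {s : Set K} {f : K} (hf : f ∈ s) : f ∈ ic B s :=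
  fun W _ h' => h' f hf

lemma ic_mono {B : Subring K} {s t : Set K} (h : s ⊆ t) : ic B s ≤ ic B t :=
  fun x hx W h1 h2 => hx W h1 fun f hf => h2 f (h hf)

/-- the localization of a valuation ring -/
def locV (W : ValuationSubring K) (f : K) (hf : f ∈ W) : ValuationSubring K where
  carrier := {x | ∃ a : ℕ, f ^ a * x ∈ W}
  mul_mem' := by
    rintro x y ⟨a, ha⟩ ⟨b, hb⟩
    refine ⟨a + b, ?_⟩
    have := mul_mem ha hb
    rwa [mul_mul_mul_comm, ← pow_add] at this
  one_mem' := ⟨0, by simp⟩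
  add_mem' := by
    rintro x y ⟨a, ha⟩ ⟨b, hb⟩
    refine ⟨a + b, ?_⟩
    have := add_mem (mul_mem (pow_mem hf b) ha) (mul_mem (pow_mem hf a) hb)
    convert this using 1
    ring
  zero_mem' := ⟨0, by simp⟩
  neg_mem' := by
    rintro x ⟨a, ha⟩
    exact ⟨a, by simpa using ha⟩
  mem_or_inv_mem' x := by
    rcases W.mem_or_inv_mem x with h | h
    · exact Or.inl ⟨0, by simpa using h⟩
    · exact Or.inr ⟨0, by simpa using h⟩

lemma exists_scale {B : Subring K} {f γ : K} (hf : f ≠ 0) (h : γ ∈ ic B {f, f⁻¹}) :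
    ∃ a0 : ℕ, ∀ a ≥ a0, f ^ a * γ ∈ ic B {f} := by
  suffices ∃ a : ℕ, f ^ a * γ ∈ ic B {f} by
    obtain ⟨a, ha⟩ := this
    refine ⟨a, fun b hb => ?_⟩
    obtain ⟨c, rfl⟩ := Nat.exists_eq_add_of_le hb
    have := mul_mem (pow_mem (subset_ic (B := B) (s := {f}) rfl) c) ha
    convert this using 1
    ring
  by_contra! hcon
  simp only [mem_ic] at hcon
  push Not at hcon
  choose w h1 h2 h3 using hcon
  let F : Ultrafilter ℕ := Filter.hyperfilter ℕ
  have hfW : f ∈ ulim F w := mem_ulim.2 (Filter.Eventually.of_forall fun i => h2 i f rfl)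
  have : γ ∈ locV (ulim F w) f hfW := by
    apply h
    · intro b hb
      exact ⟨0, by simpa using mem_ulim.2 (Filter.Eventually.of_forall fun i => h1 i b hb)⟩
    · rintro _ (rfl | rfl)
      · exact ⟨0, by simpa using hfW⟩
      · exact ⟨1, by simp [hf]⟩
  obtain ⟨b, hb⟩ := this
  have hb' := mem_ulim.1 hb
  have hge : ∀ᶠ i in F, b ≤ i := by
    have : ∀ᶠ i : ℕ in Filter.cofinite, b ≤ i := by
      rw [Nat.cofinite_eq_atTop]; exact Filter.eventually_ge_atTop b
    exact Filter.hyperfilter_le_cofinite this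
  obtain ⟨i, hi1, hi2⟩ := (hb'.and hge).exists
  apply h3 i
  obtain ⟨c, rfl⟩ := Nat.exists_eq_add_of_le hi2
  have := mul_mem (pow_mem (h2 (b + c) f rfl) c) hi1
  convert this using 1
  ring

lemma exists_fin {B : Subring K} {s : Set K} {γ : K} (h : γ ∈ ic B s) :
    ∃ t : Finset K, (t : Set K) ⊆ B ∧
      IsIntegral (Subring.closure ((t : Set K) ∪ s)) γ := by
  classical
  suffices ∃ t : Finset B, ∀ W : ValuationSubring K, (∀ b ∈ t, (b : K) ∈ W) → (∀ f ∈ s, f ∈ W) →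
      γ ∈ W by
    obtain ⟨t, ht⟩ := this
    refine ⟨t.image Subtype.val, by simp [Set.subset_def]; tauto, ?_⟩
    have := iInf_valuationSubring_superset (K := K) (s := ((t.image Subtype.val : Finset K) : Set K) ∪ s)
    change γ ∈ (integralClosure (Subring.closure (((t.image Subtype.val : Finset K) : Set K) ∪ s)) K).toSubring
    rw [← this, Subring.mem_iInf]
    rintro ⟨W, hW⟩
    refine ht W (fun b hb => hW (Or.inl ?_)) fun f hf => hW (Or.inr hf)
    simpa using hb
  by_contra! hcon
  choose w h1 h2 h3 using hcon
  let F : Ultrafilter (Finset B) := Ultrafilter.of Filter.atTop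
  have : γ ∈ ulim F w := by
    apply h
    · intro b hb
      rw [mem_ulim]
      have : ∀ᶠ S : Finset B in Filter.atTop, ⟨b, hb⟩ ∈ S := by
        filter_upwards [Filter.eventually_ge_atTop {⟨b, hb⟩}] with S hS
        exact hS (Finset.mem_singleton_self _)
      filter_upwards [Ultrafilter.of_le _ this] with S hS using h1 S _ hS
    · intro f hf
      exact mem_ulim.2 (Filter.Eventually.of_forall fun i => h2 i f hf)
  obtain ⟨i, hi⟩ := (mem_ulim.1 this).exists
  exact h3 i hi

lemma exists_expr {M : Subring K} {J : Set K} {z : M}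
    (hz : z ∈ Ideal.span ((Subtype.val : M → K) ⁻¹' J)) :
    ∃ (T H : Finset K), (T : Set K) ⊆ J ∧ (H : Set K) ⊆ M ∧
      (z : K) ∈ AddSubmonoid.closure (Set.image2 (· * ·) (T : Set K) H) := by
  classical
  rw [Submodule.mem_span_iff_exists_finset_subset] at hz
  obtain ⟨g, t, ht, -, hsum⟩ := hz
  refine ⟨t.image Subtype.val, t.image fun a => ((g a : M) : K), ?_, ?_, ?_⟩
  · intro a ha
    simp only [Finset.coe_image, Set.mem_image, Finset.mem_coe] at ha
    obtain ⟨b, hb, rfl⟩ := ha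
    exact ht hb
  · intro a ha
    simp only [Finset.coe_image, Set.mem_image, Finset.mem_coe] at ha
    obtain ⟨b, hb, rfl⟩ := ha
    exact (g b).2
  · rw [← hsum]
    rw [AddSubmonoidClass.coe_finsetSum]
    refine sum_mem fun a ha => AddSubmonoid.subset_closure ⟨a, ?_, g a, ?_, ?_⟩
    · simpa using ha
    · simp only [Finset.coe_image, Set.mem_image, Finset.mem_coe]
      exact ⟨a, ha, rfl⟩
    · simp [mul_comm]

end D
end HensConn

namespace HensConn

section D
variable {K : Type*} [Field K]

lemma glue {B : Subring K} {f : K} (hf : f ≠ 0) (q : Ideal B) {x y : K}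
    (hx : x ∈ ic B {f}) (hy : y ∈ ic B {f⁻¹})
    (hx1 : (⟨x, hx⟩ * (1 - ⟨x, hx⟩) : ic B {f}) ∈
      Ideal.span ((Subtype.val : ic B {f} → K) ⁻¹' (Subtype.val '' (q : Set B))))
    (hy1 : (⟨y, hy⟩ * (1 - ⟨y, hy⟩) : ic B {f⁻¹}) ∈
      Ideal.span ((Subtype.val : ic B {f⁻¹} → K) ⁻¹' (Subtype.val '' (q : Set B))))
    (hx0 : x ∈ ic B {f, f⁻¹}) (hy0 : y ∈ ic B {f, f⁻¹})
    (hxy : (⟨x, hx0⟩ - ⟨y, hy0⟩ : ic B {f, f⁻¹}) ∈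
      Ideal.span ((Subtype.val : ic B {f, f⁻¹} → K) ⁻¹' (Subtype.val '' (q : Set B)))) :
    ∃ c r : K, c ∈ ic B {f} ∧ c ∈ ic B {f⁻¹} ∧ r ∈ (Subtype.val '' (q : Set B)) ∧
      (∀ W ∈ RZ B (Subtype.val '' (q : Set B)), f ∈ W → c - (1 - r) * x ∈ W.nonunits) ∧
      (∀ W ∈ RZ B (Subtype.val '' (q : Set B)), f⁻¹ ∈ W → c - (1 - r) * y ∈ W.nonunits) := by
  classical
  obtain ⟨T1, H1, hT1, hH1, hE1⟩ := exists_expr hx1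
  obtain ⟨T2, H2, hT2, hH2, hE2⟩ := exists_expr hy1
  obtain ⟨T3, H3, hT3, hH3, hE3⟩ := exists_expr hxy
  clear hx1 hy1 hxy
  simp only [Subring.coe_mul, AddSubgroupClass.coe_sub, Subring.coe_one] at hE1 hE2 hE3
  generalize hJ : (Subtype.val '' (q : Set B)) = J at *
  have hJB : J ⊆ B := by
    rw [← hJ]; rintro _ ⟨b, _, rfl⟩; exact b.2
  let Γ : Finset K := {x, y} ∪ (H1 ∪ (H2 ∪ H3))
  have hΓ : ∀ γ ∈ Γ, γ ∈ ic B {f, f⁻¹} := by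
    intro γ hγ
    simp only [Γ, Finset.mem_union, Finset.mem_insert, Finset.mem_singleton] at hγ
    rcases hγ with (rfl | rfl) | h | h | h
    · exact hx0
    · exact hy0
    · exact ic_mono (by simp) (hH1 h)
    · exact ic_mono (by simp) (hH2 h)
    · exact hH3 h
  have hfin : ∀ γ : Γ, ∃ t : Finset K, (t : Set K) ⊆ B ∧
      IsIntegral (Subring.closure ((t : Set K) ∪ {f, f⁻¹})) (γ : K) :=
    fun γ => exists_fin (hΓ γ γ.2)
  choose tt htt hint using hfin
  let t : Finset K := (T1 ∪ (T2 ∪ T3)) ∪ Finset.univ.biUnion tt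
  have htB : (t : Set K) ⊆ B := by
    intro a ha
    simp only [t, Finset.coe_union, Set.mem_union, Finset.mem_coe, Finset.mem_biUnion] at ha
    rcases ha with (h | h | h) | ⟨γ, -, h⟩
    · exact hJB (hT1 h)
    · exact hJB (hT2 h)
    · exact hJB (hT3 h)
    · exact htt γ h
  let C : Subalgebra ℤ K := Algebra.adjoin ℤ (t : Set K)
  have hCn : IsNoetherianRing C := isNoetherianRing_of_fg (Subalgebra.fg_adjoin_finset t)
  have hCB : ∀ c ∈ C, c ∈ B := by
    intro c hc
    have : C ≤ subalgebraOfSubring B := Algebra.adjoin_le htB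
    exact this hc
  have htC : ∀ c ∈ t, c ∈ C := fun c hc => Algebra.subset_adjoin hc
  let L : Subalgebra C K := Algebra.adjoin C {f, f⁻¹}
  have hintL : ∀ γ ∈ (Γ : Set K), IsIntegral L γ := by
    intro γ hγ
    have h1 := hint ⟨γ, hγ⟩
    have hle : Subring.closure ((tt ⟨γ, hγ⟩ : Set K) ∪ {f, f⁻¹}) ≤ L.toSubring := by
      rw [Subring.closure_le]
      rintro a (ha | ha)
      · have : a ∈ t := by
          simp only [t, Finset.mem_union, Finset.mem_biUnion]
          exact Or.inr ⟨_, Finset.mem_univ _, ha⟩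
        exact L.algebraMap_mem ⟨a, htC a this⟩
      · exact Algebra.subset_adjoin ha
    obtain ⟨p, hp, hp0⟩ := h1
    refine ⟨p.map (Subring.inclusion hle), hp.map _, ?_⟩
    rw [Polynomial.eval₂_map]
    exact hp0
  have hfg := fg_adjoin_of_finite (R := L) (Finset.finite_toSet Γ) hintL
  obtain ⟨G, hG⟩ := hfg
  let R : Subalgebra C K := (Algebra.adjoin L (Γ : Set K)).restrictScalars C
  have hR : ∀ z, z ∈ R ↔ z ∈ Submodule.span L (G : Set K) := by
    intro z; rw [hG]; rfl
  have hLR : ∀ z ∈ L, z ∈ R := fun z hz =>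
    (Algebra.adjoin L (Γ : Set K)).algebraMap_mem ⟨z, hz⟩
  have hΓR : ∀ z ∈ Γ, z ∈ R := fun z hz => Algebra.subset_adjoin (R := L) hz
  have hfL : f ∈ L := Algebra.subset_adjoin (by simp)
  have hfL' : f⁻¹ ∈ L := Algebra.subset_adjoin (by simp)
  -- subalgebra of big ring
  let MC (s : Set K) : Subalgebra C K :=
    { (ic B s) with algebraMap_mem' := fun c => le_ic (hCB c c.2) }
  have hMC : ∀ s z, z ∈ MC s ↔ z ∈ ic B s := fun s z => Iff.rfl
  have hRM : ∀ z ∈ R, z ∈ ic B {f, f⁻¹} := by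
    intro z hz
    have hLM : L ≤ MC {f, f⁻¹} := Algebra.adjoin_le fun a ha => subset_ic ha
    have : Algebra.adjoin L (Γ : Set K) ≤
        { (ic B {f, f⁻¹}) with algebraMap_mem' := fun c => hLM c.2 } :=
      Algebra.adjoin_le fun a ha => hΓ a ha
    exact this hz
  have hGR : ∀ g ∈ G, g ∈ R := fun g hg => (hR g).2 (Submodule.subset_span hg)
  have hsc1 : ∃ a0 : ℕ, ∀ a ≥ a0, ∀ g ∈ G, f ^ a * g ∈ ic B {f} := by
    have : ∀ᶠ a : ℕ in Filter.atTop, ∀ g ∈ G, f ^ a * g ∈ ic B {f} := by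
      rw [Filter.eventually_all_finset]
      intro g hg
      rw [Filter.eventually_atTop]
      exact exists_scale hf (hRM g (hGR g hg))
    exact Filter.eventually_atTop.1 this
  have hsc2 : ∃ a0 : ℕ, ∀ a ≥ a0, ∀ g ∈ G, f⁻¹ ^ a * g ∈ ic B {f⁻¹} := by
    have : ∀ᶠ a : ℕ in Filter.atTop, ∀ g ∈ G, f⁻¹ ^ a * g ∈ ic B {f⁻¹} := by
      rw [Filter.eventually_all_finset]
      intro g hg
      rw [Filter.eventually_atTop]
      refine exists_scale (inv_ne_zero hf) ?_
      rw [inv_inv, Set.pair_comm]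
      exact hRM g (hGR g hg)
    exact Filter.eventually_atTop.1 this
  obtain ⟨a1, ha1⟩ := hsc1
  obtain ⟨a2, ha2⟩ := hsc2
  let P : Subalgebra C K := R ⊓ MC {f}
  let Q : Subalgebra C K := R ⊓ MC {f⁻¹}
  let n : Ideal C := Ideal.comap (Subring.inclusion (S := C.toSubring) hCB) q
  have hn : ∀ c : C, c ∈ n ↔ (c : K) ∈ J := by
    intro c
    rw [← hJ]
    constructor
    · intro h
      exact ⟨_, h, rfl⟩
    · rintro ⟨b, hb, hbc⟩
      have : Subring.inclusion (S := C.toSubring) hCB c = b := Subtype.ext hbc.symm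
      show Subring.inclusion (S := C.toSubring) hCB c ∈ q
      rw [this]; exact hb
  have hexp : ∀ (P : Subalgebra C K) (T H : Finset K) (z : K), (T ⊆ t) → (T : Set K) ⊆ J →
      (∀ h ∈ H, h ∈ P) → z ∈ AddSubmonoid.closure (Set.image2 (· * ·) (T : Set K) H) →
      z ∈ n • Subalgebra.toSubmodule P := by
    intro P T H z hT hTJ hH hz
    have : AddSubmonoid.closure (Set.image2 (· * ·) (T : Set K) H) ≤
        (n • Subalgebra.toSubmodule P).toAddSubmonoid := by
      rw [AddSubmonoid.closure_le]
      rintro _ ⟨a, ha, b, hb, rfl⟩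
      exact Submodule.smul_mem_smul (r := (⟨a, htC a (hT ha)⟩ : C)) ((hn _).2 (hTJ ha)) (hH b hb)
    exact this hz
  -- finite module E
  let E : Submodule C K := Submodule.span C (Set.image2 (fun (k : ℤ) (g : K) => f ^ k * g)
    (Set.Ioo (-(a2 : ℤ)) a1) G)
  have hEfg : E.FG := Submodule.fg_span (Set.Finite.image2 _ (Set.finite_Ioo _ _) G.finite_toSet)
  have hfz : ∀ k : ℤ, f ^ k ∈ R := by
    intro k
    rcases Int.eq_nat_or_neg k with ⟨m, rfl | rfl⟩
    · rw [zpow_natCast]; exact pow_mem (hLR f hfL) m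
    · rw [zpow_neg, zpow_natCast, ← inv_pow]; exact pow_mem (hLR _ hfL') m
  have hgen : ∀ g ∈ G, ∀ k : ℤ, f ^ k * g ∈
      E ⊔ (Subalgebra.toSubmodule P ⊔ Subalgebra.toSubmodule Q) := by
    intro g hg k
    by_cases h1 : (a1 : ℤ) ≤ k
    · refine Submodule.mem_sup_right (Submodule.mem_sup_left ?_)
      refine ⟨mul_mem (hfz k) (hGR g hg), ?_⟩
      obtain ⟨m, rfl⟩ := Int.eq_ofNat_of_zero_le (by omega : 0 ≤ k)
      rw [zpow_natCast]
      exact ha1 m (by omega) g hg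
    · by_cases h2 : k ≤ -(a2 : ℤ)
      · refine Submodule.mem_sup_right (Submodule.mem_sup_right ?_)
        refine ⟨mul_mem (hfz k) (hGR g hg), ?_⟩
        obtain ⟨m, hm⟩ := Int.eq_ofNat_of_zero_le (by omega : 0 ≤ -k)
        obtain rfl : k = -(m : ℤ) := by omega
        rw [zpow_neg, zpow_natCast, ← inv_pow]
        exact ha2 m (by omega) g hg
      · refine Submodule.mem_sup_left (Submodule.subset_span ⟨k, ⟨by omega, by omega⟩, g, hg, rfl⟩)
  have hRE : Subalgebra.toSubmodule R ≤
      E ⊔ (Subalgebra.toSubmodule P ⊔ Subalgebra.toSubmodule Q) := by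
    generalize E ⊔ (Subalgebra.toSubmodule P ⊔ Subalgebra.toSubmodule Q) = S at hgen
    have hL : ∀ l ∈ L, ∀ z, (∀ k : ℤ, f ^ k * z ∈ S) → (∀ k : ℤ, f ^ k * (l * z) ∈ S) := by
      intro l hl
      induction hl using Algebra.adjoin_induction with
      | mem a ha =>
        intro z hz k
        rcases ha with rfl | rfl
        · rw [← mul_assoc, ← zpow_add_one₀ hf]; exact hz _
        · rw [← mul_assoc, ← zpow_sub_one₀ hf]; exact hz _
      | algebraMap r =>
        intro z hz k
        have := S.smul_mem r (hz k)
        rw [Algebra.smul_def] at this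
        convert this using 1
        ring
      | add a b _ _ ha hb =>
        intro z hz k
        have := S.add_mem (ha z hz k) (hb z hz k)
        convert this using 1
        ring
      | mul a b _ _ ha hb =>
        intro z hz k
        rw [mul_assoc]
        exact ha _ (hb z hz) k
    intro z hz
    have hz' := (hR z).1 hz
    have : ∀ k : ℤ, f ^ k * z ∈ S := by
      induction hz' using Submodule.span_induction with
      | mem g hg => exact hgen g hg
      | zero => simp
      | add a b _ _ ha hb =>
        intro k; rw [mul_add]
        exact S.add_mem (ha ((hR _).2 ‹_›) k) (hb ((hR _).2 ‹_›) k)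
      | smul l a _ ha =>
        exact hL l l.2 a (ha ((hR _).2 ‹_›))
    simpa using this 0
  have hER : n • Subalgebra.toSubmodule R ≤
      E ⊔ (n • Subalgebra.toSubmodule P ⊔ n • Subalgebra.toSubmodule Q) := by
    refine (smul_mono_right n hRE).trans ?_
    rw [Submodule.smul_sup, Submodule.smul_sup]
    exact sup_le_sup_right Submodule.smul_le_right _
  have hxΓ : x ∈ Γ := by simp [Γ]
  have hyΓ : y ∈ Γ := by simp [Γ]
  obtain ⟨c, hcP, hcQ, r, hr, hc1, hc2⟩ := core n P Q R inf_le_left inf_le_left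
    (x := x) (y := y) ⟨hΓR x hxΓ, hx⟩ ⟨hΓR y hyΓ, hy⟩
    (hexp P T1 H1 _ (fun a ha => by simp [t, ha]) hT1
      (fun h hh => ⟨hΓR h (by simp [Γ, hh]), hH1 hh⟩) hE1)
    (hexp Q T2 H2 _ (fun a ha => by simp [t, ha]) hT2
      (fun h hh => ⟨hΓR h (by simp [Γ, hh]), hH2 hh⟩) hE2)
    (hexp R T3 H3 _ (fun a ha => by simp [t, ha]) hT3
      (fun h hh => hΓR h (by simp [Γ, hh])) hE3)
    E hEfg hER
  have hnW : ∀ (s : Set K) (W : ValuationSubring K), W ∈ RZ B J → (∀ f ∈ s, f ∈ W) →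
      ∀ z ∈ n • Subalgebra.toSubmodule (R ⊓ MC s), z ∈ W.nonunits := by
    intro s W hW hs z hz
    refine Submodule.smul_induction_on hz (fun r hr p hp => ?_) (fun a b ha hb => add_mem ha hb)
    have h1 := hW.2 _ ((hn r).1 hr)
    have h2 : p ∈ W := hp.2 W hW.1 hs
    have := nonunits_mul h2 h1
    rwa [mul_comm] at this
  refine ⟨c, r, hcP.2, hcQ.2, (hn r).1 hr, fun W hW hfW => ?_, fun W hW hfW => ?_⟩
  · exact hnW {f} W hW (by simpa using hfW) _ hc1
  · exact hnW {f⁻¹} W hW (by simpa using hfW) _ hc2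

end D
end HensConn

namespace HensConn

section Z
variable {K : Type*} [Field K]

lemma mem_of_nonunits {B : Subring K} {q : Ideal B} (hq : q.IsMaximal) {W : ValuationSubring K}
    (hW : W ∈ RZ B (Subtype.val '' (q : Set B))) {b : B} (hb : (b : K) ∈ W.nonunits) : b ∈ q := by
  by_contra hbq
  obtain ⟨y, i, hi, h⟩ := Ideal.IsMaximal.exists_inv hq hbq
  apply one_notMem_nonunits (W := W)
  have h1 : (1 : K) = y * b + i := by exact_mod_cast h.symm
  rw [h1]
  exact add_mem (nonunits_mul (hW.1 y y.2) hb) (hW.2 _ ⟨i, hi, rfl⟩)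

lemma nonunits_mul_one_sub {W : ValuationSubring K} {x : K}
    (h : x ∈ W.nonunits ∨ 1 - x ∈ W.nonunits) : x * (1 - x) ∈ W.nonunits := by
  rcases h with h | h
  · rw [mul_comm]
    exact nonunits_mul (sub_mem (one_mem W) (ValuationSubring.nonunits_le h)) h
  · refine nonunits_mul ?_ h
    have := sub_mem (one_mem W) (ValuationSubring.nonunits_le h)
    simpa using this

lemma gI_nonunits {W : ValuationSubring K} {x : K} (j : ℕ) :
    (x ∈ W.nonunits → gI^[j] x ∈ W.nonunits) ∧ (1 - x ∈ W.nonunits → 1 - gI^[j] x ∈ W.nonunits) := by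
  have hz : ∀ k : ℤ, (k : K) ∈ W := fun k => intCast_mem W k
  induction j with
  | zero => simp
  | succ j ih =>
    rw [Function.iterate_succ_apply']
    generalize gI^[j] x = z at ih
    refine ⟨fun h => ?_, fun h => ?_⟩
    · have h := ih.1 h
      have : gI z = (3 * z - 2 * (z * z)) * z := by unfold gI; ring
      rw [this]
      have hzW := ValuationSubring.nonunits_le h
      exact nonunits_mul (sub_mem (mul_mem (by exact_mod_cast hz 3) hzW)
        (mul_mem (by exact_mod_cast hz 2) (mul_mem hzW hzW))) h
    · have h := ih.2 h
      have : 1 - gI z = ((1 - z) * (3 - 2 * (1 - z))) * (1 - z) := by unfold gI; ring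
      rw [this]
      have hzW := ValuationSubring.nonunits_le h
      exact nonunits_mul (mul_mem hzW (sub_mem (by exact_mod_cast hz 3)
        (mul_mem (by exact_mod_cast hz 2) hzW))) h

lemma coe_iter {M : Subring K} (x : M) (j : ℕ) : ((gI^[j] x : M) : K) = gI^[j] (x : K) := by
  induction j with
  | zero => rfl
  | succ j ih =>
    rw [Function.iterate_succ_apply', Function.iterate_succ_apply', ← ih]
    simp [gI]
    rfl

lemma RZ_ic {B : Subring K} {s J : Set K} {W : ValuationSubring K} :
    W ∈ RZ (ic B s) J ↔ W ∈ RZ B J ∧ ∀ f ∈ s, f ∈ W := by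
  constructor
  · intro h
    exact ⟨⟨fun b hb => h.1 b (le_ic hb), h.2⟩, fun f hf => h.1 f (subset_ic hf)⟩
  · rintro ⟨h, h'⟩
    exact ⟨fun b hb => hb W h.1 h', h.2⟩

lemma lemD {B : Subring K} (hB : ∀ z : K, (∀ W : ValuationSubring K, (∀ b ∈ B, b ∈ W) → z ∈ W) → z ∈ B)
    {q : Ideal B} (hq : q.IsMaximal) {f : K} (hf : f ≠ 0) {U : ValuationSubring K → Prop} {x y : K}
    (hx : x ∈ ic B {f}) (hy : y ∈ ic B {f⁻¹})
    (hxU : ∀ W ∈ RZ (ic B {f}) (Subtype.val '' (q : Set B)),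
      (U W → x ∈ W.nonunits) ∧ (¬ U W → 1 - x ∈ W.nonunits))
    (hyU : ∀ W ∈ RZ (ic B {f⁻¹}) (Subtype.val '' (q : Set B)),
      (U W → y ∈ W.nonunits) ∧ (¬ U W → 1 - y ∈ W.nonunits)) :
    ∀ W ∈ RZ B (Subtype.val '' (q : Set B)), ∀ W' ∈ RZ B (Subtype.val '' (q : Set B)),
      U W → U W' := by
  have hJB : ∀ s, (Subtype.val '' (q : Set B)) ⊆ ic B s := by
    rintro s _ ⟨b, _, rfl⟩; exact le_ic b.2
  have hx0 : x ∈ ic B {f, f⁻¹} := ic_mono (by simp) hx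
  have hy0 : y ∈ ic B {f, f⁻¹} := ic_mono (by simp) hy
  have hRm : ∀ g ∈ ({f, f⁻¹} : Set K), ∀ W ∈ RZ (ic B {f, f⁻¹}) (Subtype.val '' (q : Set B)),
      W ∈ RZ (ic B {g}) (Subtype.val '' (q : Set B)) := by
    intro g hg W hW
    rw [RZ_ic] at hW ⊢
    exact ⟨hW.1, by simpa using hW.2 g hg⟩
  have r1 := mem_radical (hJB {f}) (mul_mem hx (sub_mem (one_mem _) hx)) fun W hW =>
    nonunits_mul_one_sub ((em (U W)).imp (hxU W hW).1 (hxU W hW).2)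
  have r2 := mem_radical (hJB {f⁻¹}) (mul_mem hy (sub_mem (one_mem _) hy)) fun W hW =>
    nonunits_mul_one_sub ((em (U W)).imp (hyU W hW).1 (hyU W hW).2)
  have r3 := mem_radical (hJB {f, f⁻¹}) (mul_mem hy0 (sub_mem (one_mem _) hy0)) fun W hW =>
    have hW := hRm f⁻¹ (by simp) W hW
    nonunits_mul_one_sub ((em (U W)).imp (hyU W hW).1 (hyU W hW).2)
  have r4 := mem_radical (hJB {f, f⁻¹}) (sub_mem hx0 hy0) fun W hW => by
    have hW1 := hRm f (by simp) W hW
    have hW2 := hRm f⁻¹ (by simp) W hW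
    by_cases hU : U W
    · exact sub_mem ((hxU W hW1).1 hU) ((hyU W hW2).1 hU)
    · have := sub_mem ((hyU W hW2).2 hU) ((hxU W hW1).2 hU)
      simpa using this
  obtain ⟨j1, hj1⟩ := iter_rad _ (⟨x, hx⟩ : ic B {f}) r1
  obtain ⟨j2, hj2⟩ := iter_rad _ (⟨y, hy⟩ : ic B {f⁻¹}) r2
  obtain ⟨j3, hj3⟩ := iter_rad_diff _ (⟨x, hx0⟩ : ic B {f, f⁻¹}) ⟨y, hy0⟩ r3 r4
  obtain ⟨j, h1, h2, h3⟩ : ∃ j, j1 ≤ j ∧ j2 ≤ j ∧ j3 ≤ j :=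
    ⟨j1 + j2 + j3, by omega, by omega, by omega⟩
  have k1 := hj1 j h1
  have k2 := hj2 j h2
  have k3 := hj3 j h3
  have e1 : gI^[j] (⟨x, hx⟩ : ic B {f}) = ⟨gI^[j] x, by rw [← coe_iter ⟨x, hx⟩]; exact SetLike.coe_mem _⟩ :=
    Subtype.ext (coe_iter _ _)
  have e2 : gI^[j] (⟨y, hy⟩ : ic B {f⁻¹}) = ⟨gI^[j] y, by rw [← coe_iter ⟨y, hy⟩]; exact SetLike.coe_mem _⟩ :=
    Subtype.ext (coe_iter _ _)
  have e3 : gI^[j] (⟨x, hx0⟩ : ic B {f, f⁻¹}) = ⟨gI^[j] x, by rw [← coe_iter ⟨x, hx0⟩]; exact SetLike.coe_mem _⟩ :=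
    Subtype.ext (coe_iter _ _)
  have e4 : gI^[j] (⟨y, hy0⟩ : ic B {f, f⁻¹}) = ⟨gI^[j] y, by rw [← coe_iter ⟨y, hy0⟩]; exact SetLike.coe_mem _⟩ :=
    Subtype.ext (coe_iter _ _)
  rw [e1] at k1
  rw [e2] at k2
  rw [e3, e4] at k3
  obtain ⟨c, r, hc1, hc2, hr, hW1, hW2⟩ := glue hf q _ _ k1 k2 _ _ k3
  have hcB : c ∈ B := hB c fun W hW => by
    rcases W.mem_or_inv_mem f with h | h
    · exact hc1 W hW (by simpa using h)
    · exact hc2 W hW (by simpa using h)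
  have aux : ∀ (W : ValuationSubring K) (z : K), r ∈ W.nonunits → c - (1 - r) * z ∈ W.nonunits →
      (z ∈ W.nonunits → c ∈ W.nonunits) ∧ (1 - z ∈ W.nonunits → 1 - c ∈ W.nonunits) := by
    intro W z hr h
    refine ⟨fun hz => ?_, fun hz => ?_⟩
    · have := add_mem h (nonunits_mul (sub_mem (one_mem W) (ValuationSubring.nonunits_le hr)) hz)
      simpa using this
    · have hzW : z ∈ W := by
        have := sub_mem (one_mem W) (ValuationSubring.nonunits_le hz)
        simpa using this
      have := add_mem (sub_mem hz h) (nonunits_mul hzW hr)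
      have e : 1 - z - (c - (1 - r) * z) + z * r = 1 - c := by ring
      rwa [e] at this
  have hfin : ∀ W ∈ RZ B (Subtype.val '' (q : Set B)),
      (U W → c ∈ W.nonunits) ∧ (¬ U W → 1 - c ∈ W.nonunits) := by
    intro W hW
    have hrW := hW.2 r hr
    rcases W.mem_or_inv_mem f with h | h
    · have a := aux W _ hrW (hW1 W hW h)
      have b := hxU W (RZ_ic.2 ⟨hW, by simpa using h⟩)
      exact ⟨fun hU => a.1 ((gI_nonunits j).1 (b.1 hU)), fun hU => a.2 ((gI_nonunits j).2 (b.2 hU))⟩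
    · have a := aux W _ hrW (hW2 W hW h)
      have b := hyU W (RZ_ic.2 ⟨hW, by simpa using h⟩)
      exact ⟨fun hU => a.1 ((gI_nonunits j).1 (b.1 hU)), fun hU => a.2 ((gI_nonunits j).2 (b.2 hU))⟩
  intro W hW W' hW' hU
  by_contra hU'
  have m1 := mem_of_nonunits hq hW (b := ⟨c, hcB⟩) ((hfin W hW).1 hU)
  have m2 := mem_of_nonunits hq hW' (b := 1 - ⟨c, hcB⟩) (by simpa using (hfin W' hW').2 hU')
  apply hq.ne_top
  rw [Ideal.eq_top_iff_one]
  simpa using add_mem m1 m2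

lemma thmZ_aux (U : ValuationSubring K → Prop) (F : Finset K) : ∀ (B : Subring K)
    (_ : ∀ z : K, (∀ W : ValuationSubring K, (∀ b ∈ B, b ∈ W) → z ∈ W) → z ∈ B)
    (q : Ideal B) (_ : q.IsMaximal) (_ : LC (RZ B (Subtype.val '' (q : Set B))) U)
    (_ : ∀ W ∈ RZ B (Subtype.val '' (q : Set B)), ∀ W' ∈ RZ B (Subtype.val '' (q : Set B)),
      (∀ f ∈ F, (f ∈ W ↔ f ∈ W') ∧ (f⁻¹ ∈ W ↔ f⁻¹ ∈ W')) → U W → U W'),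
    ∀ W ∈ RZ B (Subtype.val '' (q : Set B)), ∀ W' ∈ RZ B (Subtype.val '' (q : Set B)),
      U W → U W' := by
  classical
  induction F using Finset.induction_on with
  | empty =>
    intro B _ q _ _ h W hW W' hW'
    exact h W hW W' hW' (by simp)
  | insert f F _ ih =>
    intro B hB q hq hLC hdet
    by_cases hf : f = 0
    · refine ih B hB q hq hLC fun W hW W' hW' h => hdet W hW W' hW' fun g hg => ?_
      rcases Finset.mem_insert.1 hg with rfl | hg
      · subst hf
        simp [zero_mem]
      · exact h g hg
    have main : ∀ g : K, (g = f ∨ g = f⁻¹) → ∃ e ∈ ic B {g},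
        ∀ W ∈ RZ (ic B {g}) (Subtype.val '' (q : Set B)),
          (U W → e ∈ W.nonunits) ∧ (¬ U W → 1 - e ∈ W.nonunits) := by
      intro g hg
      have hg0 : g ≠ 0 := by
        rcases hg with rfl | rfl
        · exact hf
        · exact inv_ne_zero hf
      refine exists_sep (hLC.mono fun W hW => (RZ_ic.1 hW).1) ?_
      intro Q hQ hJQ
      have hsub : RZ (ic B {g}) (Subtype.val '' (Q : Set (ic B {g}))) ⊆
          RZ B (Subtype.val '' (q : Set B)) := by
        intro W hW
        refine ⟨(RZ_ic.1 hW).1.1, ?_⟩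
        rintro _ ⟨b, hb, rfl⟩
        exact hW.2 _ ⟨⟨b, le_ic b.2⟩, hJQ _ ⟨b, hb, rfl⟩, rfl⟩
      refine ih (ic B {g}) ?_ Q hQ (hLC.mono hsub) ?_
      · intro z hz W h1 h2
        exact hz W fun b hb => hb W h1 h2
      · intro W hW W' hW' h
        refine hdet W (hsub hW) W' (hsub hW') fun k hk => ?_
        rcases Finset.mem_insert.1 hk with rfl | hk
        · have m1 : ∀ W ∈ RZ (ic B {g}) (Subtype.val '' (Q : Set (ic B {g}))), g ∈ W :=
            fun W hW => (RZ_ic.1 hW).2 g rfl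
          have m2 : ∀ W ∈ RZ (ic B {g}) (Subtype.val '' (Q : Set (ic B {g}))),
              (g⁻¹ ∈ W ↔ (⟨g, subset_ic rfl⟩ : ic B {g}) ∉ Q) := by
            intro W hW
            have h1 : g ∈ W.nonunits ↔ (⟨g, subset_ic rfl⟩ : ic B {g}) ∈ Q :=
              ⟨fun h => mem_of_nonunits hQ hW h, fun h => hW.2 _ ⟨_, h, rfl⟩⟩
            rw [← h1, ValuationSubring.mem_nonunits_iff_or]
            simp [hg0]
          have a1 : g ∈ W ↔ g ∈ W' := by simp [m1 W hW, m1 W' hW']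
          have a2 : g⁻¹ ∈ W ↔ g⁻¹ ∈ W' := by rw [m2 W hW, m2 W' hW']
          rcases hg with rfl | rfl
          · exact ⟨a1, a2⟩
          · rw [inv_inv] at a2
            exact ⟨a2, a1⟩
        · exact h k hk
    obtain ⟨x, hx, hxU⟩ := main f (Or.inl rfl)
    obtain ⟨y, hy, hyU⟩ := main f⁻¹ (Or.inr rfl)
    exact lemD hB hq hf hx hy hxU hyU

theorem thmZ {U : ValuationSubring K → Prop} {B : Subring K}
    (hB : ∀ z : K, (∀ W : ValuationSubring K, (∀ b ∈ B, b ∈ W) → z ∈ W) → z ∈ B)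
    {q : Ideal B} (hq : q.IsMaximal) (hLC : LC (RZ B (Subtype.val '' (q : Set B))) U) :
    ∀ W ∈ RZ B (Subtype.val '' (q : Set B)), ∀ W' ∈ RZ B (Subtype.val '' (q : Set B)),
      U W → U W' := by
  obtain ⟨F, hF⟩ := exists_finite_det hLC
  exact thmZ_aux U F B hB q hq hLC fun W hW W' hW' h => hF W hW W' hW' fun f hf => (h f hf).1

/-- global separation -/
theorem sepZ {U : ValuationSubring K → Prop} {B : Subring K}
    (hB : ∀ z : K, (∀ W : ValuationSubring K, (∀ b ∈ B, b ∈ W) → z ∈ W) → z ∈ B)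
    {J : Set K} (hJ : J ⊆ B) (hLC : LC (RZ B J) U) :
    ∃ e ∈ B, ∀ W ∈ RZ B J, (U W → e ∈ W.nonunits) ∧ (¬ U W → 1 - e ∈ W.nonunits) := by
  refine exists_sep hLC fun Q hQ hJQ => thmZ hB hQ (hLC.mono fun W hW => ⟨hW.1, fun b hb => ?_⟩)
  exact hW.2 _ ⟨⟨b, hJ hb⟩, hJQ _ hb, rfl⟩

end Z
end HensConn

namespace HensConn

section Hensel
open Polynomial

/-- universal polynomial -/
noncomputable def Huniv (n s : ℕ) : (MvPolynomial (Fin n) ℤ)[X] :=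
  ∏ S ∈ Finset.powersetCard s (Finset.univ : Finset (Fin n)),
    (X - C (∏ i ∈ S, MvPolynomial.X i))

lemma Huniv_symm (n s : ℕ) (k : ℕ) : ((Huniv n s).coeff k).IsSymmetric := by
  classical
  intro τ
  have h : (Huniv n s).map (MvPolynomial.rename τ : MvPolynomial (Fin n) ℤ →ₐ[ℤ] _).toRingHom
      = Huniv n s := by
    unfold Huniv
    rw [Polynomial.map_prod]
    refine Finset.prod_bij (fun S _ => S.map τ.toEmbedding) ?_ ?_ ?_ ?_
    · intro S hS
      rw [Finset.mem_powersetCard] at hS ⊢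
      exact ⟨Finset.subset_univ _, by rw [Finset.card_map]; exact hS.2⟩
    · intro S _ S' _ h
      exact Finset.map_injective _ h
    · intro S hS
      rw [Finset.mem_powersetCard] at hS
      refine ⟨S.map τ.symm.toEmbedding, ?_, ?_⟩
      · rw [Finset.mem_powersetCard]
        exact ⟨Finset.subset_univ _, by rw [Finset.card_map]; exact hS.2⟩
      · ext i; simp
    · intro S hS
      simp only [Polynomial.map_sub, Polynomial.map_X, Polynomial.map_C, Finset.prod_map]
      congr 2
      erw [map_prod]
      simp
  have := congrArg (fun p => p.coeff k) h
  simpa [coeff_map] using this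

lemma exists_univ (n s : ℕ) : ∃ H : (MvPolynomial (Fin n) ℤ)[X], H.Monic ∧
    H.map (MvPolynomial.aeval (R := ℤ) fun i : Fin n =>
      MvPolynomial.esymm (Fin n) ℤ (i + 1)).toRingHom = Huniv n s := by
  have hm : (Huniv n s).Monic := monic_prod_of_monic _ _ fun S _ => monic_X_sub_C _
  have hl : Huniv n s ∈ lifts (MvPolynomial.aeval (R := ℤ) fun i : Fin n =>
      MvPolynomial.esymm (Fin n) ℤ (i + 1)).toRingHom := by
    rw [lifts_iff_coeff_lifts]
    intro k
    obtain ⟨p, hp⟩ := MvPolynomial.esymmAlgHom_surjective (σ := Fin n) (n := n) ℤ (by simp)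
      ⟨_, Huniv_symm n s k⟩
    refine ⟨p, ?_⟩
    have := congrArg Subtype.val hp
    rw [MvPolynomial.esymmAlgHom_apply] at this
    exact this
  obtain ⟨q, hq1, -, hq2⟩ := lifts_and_degree_eq_and_monic hl hm
  exact ⟨q, hq2, hq1⟩

lemma exists_H (n s : ℕ) {A : Type u} [CommRing A] (G : A[X]) :
    ∃ H : A[X], H.Monic ∧ ∀ (R : Type u) [CommRing R] (φ : A →+* R) (e : Fin n → R),
      G.map φ = ∏ i, (X - C (e i)) →
      H.map φ = ∏ S ∈ Finset.powersetCard s (Finset.univ : Finset (Fin n)),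
        (X - C (∏ i ∈ S, e i)) := by
  obtain ⟨H, hH, hHu⟩ := exists_univ n s
  let a : Fin n → A := fun i => (-1) ^ ((i : ℕ) + 1) * G.coeff (n - (i + 1))
  refine ⟨H.map (MvPolynomial.aeval (R := ℤ) a).toRingHom, hH.map _, fun R _ φ e hG => ?_⟩
  have key : φ.comp (MvPolynomial.aeval (R := ℤ) a).toRingHom =
      (MvPolynomial.aeval (R := ℤ) e).toRingHom.comp (MvPolynomial.aeval (R := ℤ) fun i : Fin n =>
        MvPolynomial.esymm (Fin n) ℤ (i + 1)).toRingHom := by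
    apply MvPolynomial.ringHom_ext
    · intro r; simp
    · intro i
      simp only [AlgHom.toRingHom_eq_coe, RingHom.coe_comp, RingHom.coe_coe, Function.comp_apply,
        MvPolynomial.aeval_X]
      rw [MvPolynomial.aeval_esymm_eq_multiset_esymm]
      have h1 : φ (G.coeff (n - (i + 1))) = (G.map φ).coeff (n - (i + 1)) := by rw [coeff_map]
      have h2 : (∏ i, (X - C (e i))) = ((Finset.univ.val.map e).map fun t => X - C t).prod := by
        rw [Multiset.map_map]; rfl
      have hc : Multiset.card (Finset.univ.val.map e) = n := by simp
      have hi := i.2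
      simp only [a, map_mul, map_pow, map_neg, map_one]
      rw [h1, hG, h2, Multiset.prod_X_sub_C_coeff _ (by rw [hc]; omega), hc,
        show n - (n - ((i : ℕ) + 1)) = i + 1 by omega, ← mul_assoc, ← mul_pow]
      simp
  rw [Polynomial.map_map, key, ← Polynomial.map_map, hHu]
  unfold Huniv
  rw [Polynomial.map_prod]
  refine Finset.prod_congr rfl fun S _ => ?_
  simp only [Polynomial.map_sub, Polynomial.map_X, Polynomial.map_C]
  congr 2
  erw [map_prod]
  simp


lemma exG {A : Type u} [CommRing A] (I : Ideal A) {K : Type u} [CommRing K] [IsDomain K]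
    [Algebra A K] [Algebra.IsIntegral A K] (x : K)
    (hx : x * (1 - x) ∈ (I.map (algebraMap A K)).radical) :
    ∃ (s : ℕ) (G : A[X]), G.Monic ∧ G.natDegree = s + s ∧ aeval x G = 0 ∧
      ∀ (R : Type u) [CommRing R] (φ : A →+* R), (∀ a ∈ I, φ a = 0) →
      G.map φ = X ^ s * (X - C 1) ^ s := by
  obtain ⟨k, hk⟩ := hx
  have hk' : (x * (x - 1)) ^ (k + 1) ∈ I.map (algebraMap A K) := by
    have : (x * (x - 1)) ^ (k + 1) = ((-1) ^ (k + 1) * (x * (1 - x))) * (x * (1 - x)) ^ k := by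
      rw [show x * (x - 1) = (-1) * (x * (1 - x)) by ring, mul_pow]; ring
    rw [this]
    exact Ideal.mul_mem_left _ _ hk
  obtain ⟨p, hpm, hp0, hpI⟩ := Polynomial.exists_monic_aeval_eq_zero_forall_mem_of_mem_map hk'
  have hA : Nontrivial A := (algebraMap A K).domain_nontrivial
  have hGm : (p.comp ((X * (X - C 1)) ^ (k + 1))).Monic := by
    refine hpm.comp (((monic_X).mul (monic_X_sub_C 1)).pow _) ?_
    rw [Monic.natDegree_pow ((monic_X).mul (monic_X_sub_C 1)),
      Monic.natDegree_mul monic_X (monic_X_sub_C 1)]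
    simp
  refine ⟨p.natDegree * (k + 1), p.comp ((X * (X - C 1)) ^ (k + 1)), hGm, ?_, ?_, ?_⟩
  · rw [← hGm.natDegree_map (algebraMap A K), Polynomial.map_comp, natDegree_comp,
      hpm.natDegree_map, Polynomial.map_pow, Polynomial.map_mul, Polynomial.map_sub,
      Polynomial.map_X, Polynomial.map_C, natDegree_pow,
      Monic.natDegree_mul monic_X (monic_X_sub_C _)]
    simp only [natDegree_X, natDegree_X_sub_C]
    ring
  · rw [aeval_comp]
    simpa using hp0
  · intro R _ φ hφ
    have : p.map φ = X ^ p.natDegree := by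
      ext i
      rw [coeff_map, coeff_X_pow]
      split_ifs with h
      · rw [h, hpm.coeff_natDegree, map_one]
      · exact hφ _ (hpI i h)
    rw [Polynomial.map_comp, this, X_pow_comp, Polynomial.map_pow, Polynomial.map_mul,
      Polynomial.map_sub, Polynomial.map_X, Polynomial.map_C, map_one]
    rw [mul_pow, mul_pow, ← pow_mul, ← pow_mul, mul_comm (k + 1)]

lemma exRoots {A : Type u} [CommRing A] {K : Type u} [Field K]
    [IsAlgClosed K] [Algebra A K] (G : A[X]) (hGm : G.Monic) (n : ℕ) (hGdeg : G.natDegree = n) :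
    ∃ e : Fin n → integralClosure A K,
      G.map (algebraMap A (integralClosure A K)) = ∏ i, (X - C (e i)) := by
  have hA : Nontrivial A := (algebraMap A K).domain_nontrivial
  have hsp := IsAlgClosed.splits (G.map (algebraMap A K))
  have hprod := hsp.eq_prod_roots_of_monic (hGm.map _)
  have hcard : Multiset.card (G.map (algebraMap A K)).roots = n := by
    rw [← hsp.natDegree_eq_card_roots, hGm.natDegree_map, hGdeg]
  have hroot : ∀ r ∈ (G.map (algebraMap A K)).roots, _root_.IsIntegral A r := by
    intro r hr
    refine ⟨G, hGm, ?_⟩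
    have := (mem_roots'.1 hr).2
    rwa [IsRoot, Polynomial.eval_map] at this
  obtain ⟨l, hl⟩ := Quot.exists_rep (G.map (algebraMap A K)).roots
  have hl' : (l : Multiset K) = (G.map (algebraMap A K)).roots := hl
  rw [← hl'] at hprod hcard hroot
  have hlen : l.length = n := by simpa using hcard
  subst hlen
  refine ⟨fun i => ⟨l.get i, hroot _ (by simp)⟩, ?_⟩
  apply Polynomial.map_injective (algebraMap (integralClosure A K) K) Subtype.val_injective
  rw [Polynomial.map_map, ← IsScalarTower.algebraMap_eq, hprod, Polynomial.map_prod]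
  simp only [Polynomial.map_sub, Polynomial.map_X, Polynomial.map_C]
  rw [Multiset.map_coe, Multiset.prod_coe]
  conv_lhs => rw [← List.ofFn_get l, List.map_ofFn, List.prod_ofFn]
  rfl

lemma exHroot {A : Type u} [CommRing A] (I : Ideal A) [HenselianRing A I] (s : ℕ) (G : A[X])
    (hGφ : G.map (Ideal.Quotient.mk I) = X ^ s * (X - C 1) ^ s) :
    ∃ a : A, a - 1 ∈ I ∧ ∀ (R : Type u) [CommRing R] [IsDomain R] (φ : A →+* R)
      (e : Fin (s + s) → R), G.map φ = ∏ i, (X - C (e i)) →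
      ∃ S : Finset (Fin (s + s)), S.card = s ∧ φ a = ∏ i ∈ S, e i := by
  classical
  obtain ⟨H, hHm, hH⟩ := exists_H (s + s) s G
  let T : Finset (Fin (s + s)) := Finset.univ.map (Fin.natAddEmb s)
  have hTc : T.card = s := by simp [T]
  have hTmem : T ∈ Finset.powersetCard s (Finset.univ : Finset (Fin (s + s))) := by
    rw [Finset.mem_powersetCard]; exact ⟨Finset.subset_univ _, hTc⟩
  let ε : Fin (s + s) → A ⧸ I := Fin.addCases (fun _ => 0) (fun _ => 1)
  have hε0 : ∀ i, ε (Fin.castAdd s i) = 0 := fun i => Fin.addCases_left _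
  have hε1 : ∀ i, ε (Fin.natAdd s i) = 1 := fun i => Fin.addCases_right _
  have hHI := hH (A ⧸ I) (Ideal.Quotient.mk I) ε (by
    rw [hGφ, Fin.prod_univ_add]
    simp only [hε0, hε1, Finset.prod_const, Finset.card_univ, Fintype.card_fin]
    simp)
  have hT1 : ∏ i ∈ T, ε i = 1 := by
    rw [Finset.prod_map]
    exact Finset.prod_eq_one fun i _ => hε1 i
  have hS0 : ∀ S ∈ (Finset.powersetCard s (Finset.univ : Finset (Fin (s + s)))).erase T,
      ∏ i ∈ S, ε i = 0 := by
    intro S hS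
    rw [Finset.mem_erase, Finset.mem_powersetCard] at hS
    have : ¬ S ⊆ T := fun h => hS.1 (Finset.eq_of_subset_of_card_le h (by rw [hTc, hS.2.2]))
    obtain ⟨i, hi, hiT⟩ := Finset.not_subset.1 this
    refine Finset.prod_eq_zero hi ?_
    induction i using Fin.addCases with
    | left i => exact hε0 i
    | right i => exact absurd (Finset.mem_map_of_mem (Fin.natAddEmb s) (Finset.mem_univ i)) hiT
  have hHI' : H.map (Ideal.Quotient.mk I) = (X - C 1) * ∏ S ∈
      (Finset.powersetCard s (Finset.univ : Finset (Fin (s + s)))).erase T, X := by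
    rw [hHI, ← Finset.mul_prod_erase _ _ hTmem, hT1]
    congr 1
    refine Finset.prod_congr rfl fun S hS => ?_
    rw [hS0 S hS]; simp
  obtain ⟨a, ha, haI⟩ := HenselianRing.is_henselian (I := I) H hHm 1
    (by
      rw [← Ideal.Quotient.eq_zero_iff_mem, ← eval_map_apply, hHI']
      simp)
    (by
      rw [← eval_map_apply, ← derivative_map, hHI']
      simp [derivative_mul])
  refine ⟨a, haI, fun R _ _ φ e he => ?_⟩
  have hHS := hH R φ e he
  have hz : (H.map φ).eval (φ a) = 0 := by
    rw [eval_map_apply, ha, map_zero]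
  rw [hHS, eval_prod, Finset.prod_eq_zero_iff] at hz
  obtain ⟨S, hS, hSa⟩ := hz
  rw [Finset.mem_powersetCard] at hS
  rw [eval_sub, eval_X, eval_C, sub_eq_zero] at hSa
  exact ⟨S, hS.2, hSa⟩

lemma count_roots {R : Type u} [CommRing R] [IsDomain R] {s : ℕ} (f : Fin (s + s) → R)
    (h : ∏ i, (X - C (f i)) = (X ^ s * (X - C 1) ^ s : R[X])) (S : Finset (Fin (s + s)))
    (hS : S.card = s) (hS1 : ∏ i ∈ S, f i = 1) :
    (∀ i ∈ S, f i = 1) ∧ (∀ i ∉ S, f i = 0) := by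
  classical
  have hroots : (∏ i, (X - C (f i))).roots = Finset.univ.val.map f := by
    rw [Polynomial.roots_prod]
    · simp
    · exact Finset.prod_ne_zero_iff.2 fun i _ => X_sub_C_ne_zero _
  have hroots2 : (X ^ s * (X - C 1) ^ s : R[X]).roots = s • {0} + s • {1} := by
    rw [roots_mul, roots_pow, roots_pow, roots_X, roots_X_sub_C]
    exact mul_ne_zero (pow_ne_zero _ X_ne_zero) (pow_ne_zero _ (X_sub_C_ne_zero _))
  rw [h, hroots2] at hroots
  have hcount : (Finset.univ.filter fun i => 0 = f i).card = s := by
    have := congrArg (Multiset.count 0) hroots.symm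
    rw [Multiset.count_map] at this
    rw [← Finset.filter_val, Finset.card_val] at this
    simp only [Multiset.count_add, Multiset.count_nsmul, Multiset.count_singleton] at this
    simpa using this
  have h01 : ∀ i, f i = 0 ∨ f i = 1 := by
    intro i
    have : f i ∈ Finset.univ.val.map f := Multiset.mem_map_of_mem _ (Finset.mem_univ i)
    rw [← hroots, Multiset.mem_add] at this
    rcases this with h | h
    · exact Or.inl (Multiset.mem_singleton.1 (Multiset.mem_of_mem_nsmul h))
    · exact Or.inr (Multiset.mem_singleton.1 (Multiset.mem_of_mem_nsmul h))
  have hSne : ∀ i ∈ S, f i ≠ 0 := by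
    intro i hi h0
    rw [Finset.prod_eq_zero hi h0] at hS1
    exact zero_ne_one hS1
  have hcompl : (Finset.univ.filter fun i => 0 = f i) = Sᶜ := by
    apply Finset.eq_of_subset_of_card_le
    · intro i hi
      rw [Finset.mem_compl]
      exact fun h => hSne i h (Finset.mem_filter.1 hi).2.symm
    · rw [hcount, Finset.card_compl, hS]; simp
  refine ⟨fun i hi => (h01 i).resolve_left (hSne i hi), fun i hi => ?_⟩
  have : i ∈ Sᶜ := Finset.mem_compl.2 hi
  rw [← hcompl] at this
  exact (Finset.mem_filter.1 this).2.symm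

lemma hensel_aux {A : Type u} [CommRing A] (I : Ideal A) [HenselianRing A I] {D : Type u} [CommRing D]
    [IsDomain D] [Algebra A D] [Algebra.IsIntegral A D] (hD : ∀ (G : A[X]) (n : ℕ), G.Monic → G.natDegree = n →
      ∃ e : Fin n → D, G.map (algebraMap A D) = ∏ i, (X - C (e i))) (x : D)
    (hx : x * (1 - x) ∈ (I.map (algebraMap A D)).radical) :
    (∀ P : Ideal D, P.IsPrime → I.map (algebraMap A D) ≤ P → x ∈ P) ∨
    (∀ P : Ideal D, P.IsPrime → I.map (algebraMap A D) ≤ P → 1 - x ∈ P) := by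
  classical
  obtain ⟨s, G, hGm, hGdeg, hGx, hGφ⟩ := exG I x hx
  obtain ⟨e, he⟩ := hD G _ hGm hGdeg
  obtain ⟨i0, hi0⟩ : ∃ i0, e i0 = x := by
    have h1 : (G.map (algebraMap A D)).eval x = 0 := by
      rw [eval_map_algebraMap]; exact hGx
    rw [he, eval_prod, Finset.prod_eq_zero_iff] at h1
    obtain ⟨i, -, hi⟩ := h1
    rw [eval_sub, eval_X, eval_C, sub_eq_zero] at hi
    exact ⟨i, hi.symm⟩
  obtain ⟨a, haI, ha⟩ := exHroot I s G (hGφ _ _ fun a ha => Ideal.Quotient.eq_zero_iff_mem.2 ha)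
  obtain ⟨S, hS, hSa⟩ := ha D (algebraMap A D) e he
  have main : ∀ P : Ideal D, P.IsPrime →
      I.map (algebraMap A D) ≤ P →
      (∀ i ∈ S, 1 - e i ∈ P) ∧ (∀ i ∉ S, e i ∈ P) := by
    intro P hP hIP
    have hφ : ∀ a ∈ I, ((Ideal.Quotient.mk P).comp (algebraMap A D)) a = 0 := fun a ha =>
      Ideal.Quotient.eq_zero_iff_mem.2 (hIP (Ideal.mem_map_of_mem _ ha))
    have h1 := hGφ _ _ hφ
    have h2 := congrArg (Polynomial.map (Ideal.Quotient.mk P)) he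
    rw [Polynomial.map_map, h1, Polynomial.map_prod] at h2
    simp only [Polynomial.map_sub, Polynomial.map_X, Polynomial.map_C] at h2
    obtain ⟨c1, c2⟩ := count_roots (fun i => Ideal.Quotient.mk P (e i)) h2.symm S hS (by
      have := hφ _ haI
      rw [map_sub, map_one, sub_eq_zero] at this
      rw [← this, RingHom.comp_apply, hSa, map_prod])
    refine ⟨fun i hi => ?_, fun i hi => Ideal.Quotient.eq_zero_iff_mem.1 (c2 i hi)⟩
    rw [← Ideal.Quotient.eq_zero_iff_mem, map_sub, map_one, sub_eq_zero]
    exact (c1 i hi).symm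
  by_cases hi : i0 ∈ S
  · right
    intro P hP hIP
    rw [← hi0]; exact (main P hP hIP).1 i0 hi
  · left
    intro P hP hIP
    rw [← hi0]; exact (main P hP hIP).2 i0 hi

set_option maxHeartbeats 1000000 in
lemma hensel {A : Type u} [CommRing A] (I : Ideal A) [HenselianRing A I] {K : Type u} [Field K]
    [IsAlgClosed K] [Algebra A K] (x : integralClosure A K)
    (hx : x * (1 - x) ∈ (I.map (algebraMap A (integralClosure A K))).radical) :
    (∀ P : Ideal (integralClosure A K), P.IsPrime → I.map (algebraMap A (integralClosure A K)) ≤ P →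
      x ∈ P) ∨
    (∀ P : Ideal (integralClosure A K), P.IsPrime → I.map (algebraMap A (integralClosure A K)) ≤ P →
      1 - x ∈ P) :=
  hensel_aux I (fun G n h1 h2 => exRoots G h1 n h2) x hx

end Hensel
end HensConn

namespace HensConn

lemma ic_mem {A : Type u} [CommRing A] {K : Type u} [Field K] [Algebra A K]
    (z : K) : (∀ W : ValuationSubring K, (∀ b ∈ (integralClosure A K).toSubring, b ∈ W) → z ∈ W) →
      z ∈ (integralClosure A K).toSubring := by
  intro h
  have : IsIntegrallyClosedIn (integralClosure A K).toSubring K :=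
    inferInstanceAs (IsIntegrallyClosedIn (integralClosure A K) K)
  rw [Subring.eq_iInf_of_isIntegrallyClosedIn (R := (integralClosure A K).toSubring)]
  rw [Subring.mem_iInf]
  exact fun V => h V.1 fun b hb => V.2 hb

lemma not_both {K : Type u} [Field K] {W : ValuationSubring K} {e : K} (h1 : e ∈ W.nonunits)
    (h2 : 1 - e ∈ W.nonunits) : False := by
  rw [ValuationSubring.mem_nonunits_iff] at h1 h2
  have := W.valuation.map_add_lt h1 h2
  simp at this

lemma mem_W_of_integral {A : Type u} [CommRing A] {K : Type u} [Field K] [Algebra A K]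
    (W : ValuationSubring K) (h : ∀ a, algebraMap A K a ∈ W) (z : K) (hz : _root_.IsIntegral A z) : z ∈ W := by
  let φ : A →+* W := (algebraMap A K).codRestrict W.toSubring h
  have : _root_.IsIntegral W z := by
    obtain ⟨p, hp, hp0⟩ := hz
    refine ⟨p.map φ, hp.map _, ?_⟩
    rw [Polynomial.eval₂_map]
    exact hp0
  obtain ⟨y, hy⟩ := IsIntegrallyClosed.isIntegral_iff.1 this
  rw [← hy]; exact y.2

set_option maxHeartbeats 1000000 in
theorem noSep {A : Type u} [CommRing A] (I : Ideal A) [HenselianRing A I] {K : Type u} [Field K]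
    [IsAlgClosed K] [Algebra A K] (U : ValuationSubring K → Prop)
    (hLC : LC (RZ (algebraMap A K).range (algebraMap A K '' I)) U) {W W' : ValuationSubring K}
    (hW : W ∈ RZ (algebraMap A K).range (algebraMap A K '' I))
    (hW' : W' ∈ RZ (algebraMap A K).range (algebraMap A K '' I)) (hU : U W) : U W' := by
  by_contra hU'
  have hsub : RZ (algebraMap A K).range (algebraMap A K '' I) =
      RZ (integralClosure A K).toSubring (algebraMap A K '' I) := by
    ext V
    constructor
    · rintro ⟨h1, h2⟩
      exact ⟨fun b hb => mem_W_of_integral V (fun a => h1 _ ⟨a, rfl⟩) b hb, h2⟩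
    · rintro ⟨h1, h2⟩
      refine ⟨?_, h2⟩
      rintro _ ⟨a, rfl⟩
      exact h1 _ isIntegral_algebraMap
  rw [hsub] at hLC hW hW'
  have hJ : algebraMap A K '' I ⊆ (integralClosure A K).toSubring := by
    rintro _ ⟨a, -, rfl⟩
    exact isIntegral_algebraMap
  obtain ⟨e, heB, he⟩ := sepZ ic_mem hJ hLC
  have h1 : e * (1 - e) ∈ (integralClosure A K).toSubring :=
    mul_mem heB (sub_mem (one_mem _) heB)
  have h2 := mem_radical (g := e * (1 - e)) hJ h1 (fun V hV => nonunits_mul_one_sub (by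
    by_cases hV' : U V
    · exact Or.inl ((he V hV).1 hV')
    · exact Or.inr ((he V hV).2 hV')))
  have h3 : Ideal.span ((Subtype.val : (integralClosure A K).toSubring → K) ⁻¹' (algebraMap A K '' I))
      = I.map (algebraMap A (integralClosure A K)) := by
    unfold Ideal.map
    congr 1
    ext y
    constructor
    · rintro ⟨a, ha, hay⟩
      exact ⟨a, ha, Subtype.ext hay⟩
    · rintro ⟨a, ha, rfl⟩
      exact ⟨a, ha, rfl⟩
  rw [h3] at h2
  have hprime : ∀ V ∈ RZ (integralClosure A K).toSubring (algebraMap A K '' I),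
      ∃ P : Ideal (integralClosure A K), P.IsPrime ∧
        I.map (algebraMap A (integralClosure A K)) ≤ P ∧ ∀ y : integralClosure A K, y ∈ P →
        (y : K) ∈ V.nonunits := by
    intro V hV
    let φ : integralClosure A K →+* V :=
      ((integralClosure A K).val : integralClosure A K →+* K).codRestrict V.toSubring
        fun b => hV.1 _ b.2
    have key : ∀ y, y ∈ (IsLocalRing.maximalIdeal V).comap φ ↔ (y : K) ∈ V.nonunits := by
      intro y
      rw [Ideal.mem_comap, ← ValuationSubring.coe_mem_nonunits_iff]
      rfl
    refine ⟨(IsLocalRing.maximalIdeal V).comap φ, inferInstance, ?_, fun y hy => (key y).1 hy⟩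
    rw [Ideal.map_le_iff_le_comap]
    intro a ha
    rw [Ideal.mem_comap, key]
    exact hV.2 _ ⟨a, ha, rfl⟩
  obtain ⟨P, hP, hIP, hPW⟩ := hprime W hW
  obtain ⟨P', hP', hIP', hPW'⟩ := hprime W' hW'
  have a1 := (he W hW).1 hU
  have a2 := (he W' hW').2 hU'
  rcases hensel I (K := K) ⟨e, heB⟩ h2 with h | h
  · have := hPW' _ (h P' hP' hIP')
    exact not_both this a2
  · have := hPW _ (h P hP hIP)
    exact not_both a1 this

end HensConn

namespace HensConn

section Sch
variable {A : Type u} [CommRing A] {X : Scheme.{u}} (f : X ⟶ Spec (CommRingCat.of A))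
  {K : Type u} [Field K] [Algebra A K] (ξ : Spec (CommRingCat.of K) ⟶ X)

/-- center -/
def Cen (W : ValuationSubring K) (x : X) : Prop :=
  ∃ l : Spec (CommRingCat.of W) ⟶ X,
    Spec.map (CommRingCat.ofHom (algebraMap W K)) ≫ l = ξ ∧ l (IsLocalRing.closedPoint W) = x

variable {f ξ}

lemma Cen.lift (hξ : ξ ≫ f = Spec.map (CommRingCat.ofHom (algebraMap A K)))
    {W : ValuationSubring K} {l : Spec (CommRingCat.of W) ⟶ X}
    (hl : Spec.map (CommRingCat.ofHom (algebraMap W K)) ≫ l = ξ) :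
    ∃ ψ : A →+* W, l ≫ f = Spec.map (CommRingCat.ofHom ψ) ∧ ∀ a, (ψ a : K) = algebraMap A K a := by
  obtain ⟨ψ, hψ⟩ := Spec.map_surjective (l ≫ f)
  refine ⟨ψ.hom, hψ.symm, ?_⟩
  have h : Spec.map (ψ ≫ CommRingCat.ofHom (algebraMap W K)) =
      Spec.map (CommRingCat.ofHom (algebraMap A K)) := by
    rw [Spec.map_comp, hψ, ← Category.assoc, hl, hξ]
  have h2 := Spec.map_injective h
  intro a
  exact congrArg (fun g => g.hom a) h2

lemma Cen.mem (hξ : ξ ≫ f = Spec.map (CommRingCat.ofHom (algebraMap A K)))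
    {W : ValuationSubring K} {x : X} (h : Cen ξ W x) :
    (∀ a, algebraMap A K a ∈ W) ∧ ∀ a, a ∈ (f x).asIdeal ↔ algebraMap A K a ∈ W.nonunits := by
  obtain ⟨l, hl, rfl⟩ := h
  obtain ⟨ψ, h1, h2⟩ := Cen.lift hξ hl
  refine ⟨fun a => by rw [← h2]; exact (ψ a).2, fun a => ?_⟩
  have h3 : f (l (IsLocalRing.closedPoint W)) =
      Spec.map (CommRingCat.ofHom ψ) (IsLocalRing.closedPoint W) := by
    rw [← h1]; rfl
  rw [h3, ← h2, ValuationSubring.coe_mem_nonunits_iff]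
  rfl

lemma Cen.exists [UniversallyClosed f] (hξ : ξ ≫ f = Spec.map (CommRingCat.ofHom (algebraMap A K)))
    {W : ValuationSubring K} (hW : ∀ a, algebraMap A K a ∈ W) : ∃ x, Cen ξ W x := by
  have H : ValuativeCriterion.Existence f := by
    have : UniversallyClosed f := inferInstance
    rw [UniversallyClosed.eq_valuativeCriterion] at this
    exact this.1
  let ψ : A →+* W := (algebraMap A K).codRestrict W.toSubring hW
  have w : ξ ≫ f = Spec.map (CommRingCat.ofHom (algebraMap W K)) ≫
      Spec.map (CommRingCat.ofHom ψ) := by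
    rw [hξ, ← Spec.map_comp]
    rfl
  obtain ⟨l, hl₁, hl₂⟩ := (H { R := W, K := K, commSq := ⟨w⟩, .. }).exists_lift
  exact ⟨_, l, hl₁, rfl⟩

lemma Cen.unique [IsSeparated f] (hξ : ξ ≫ f = Spec.map (CommRingCat.ofHom (algebraMap A K)))
    {W : ValuationSubring K} {x y : X} (hx : Cen ξ W x) (hy : Cen ξ W y) : x = y := by
  have H := IsSeparated.valuativeCriterion f
  obtain ⟨l, hl, rfl⟩ := hx
  obtain ⟨m, hm, rfl⟩ := hy
  obtain ⟨ψ, h1, h2⟩ := Cen.lift hξ hl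
  obtain ⟨ψ', h1', h2'⟩ := Cen.lift hξ hm
  have : ψ' = ψ := by
    ext a; rw [h2, h2']
  subst this
  have w : ξ ≫ f = Spec.map (CommRingCat.ofHom (algebraMap W K)) ≫
      Spec.map (CommRingCat.ofHom ψ') := by
    rw [← h1, ← Category.assoc, hl]
  let S : ValuativeCommSq f := { R := W, K := K, commSq := ⟨w⟩, .. }
  have := H S
  have e : (⟨l, hl, h1⟩ : S.commSq.LiftStruct) = ⟨m, hm, h1'⟩ := Subsingleton.elim _ _
  have e' : l = m := congrArg CommSq.LiftStruct.l e
  rw [e']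

lemma Cen.exists_of_specializes {u : X}
    (h : ξ (IsLocalRing.closedPoint K) ⤳ u) : ∃ W, Cen ξ W u := by
  let φ : X.presheaf.stalk u ⟶ CommRingCat.of K :=
    X.presheaf.stalkSpecializes h ≫ Scheme.stalkClosedPointTo ξ
  obtain ⟨W, hW, hWl⟩ := IsLocalRing.exists_factor_valuationRing φ.hom
  let θ : X.presheaf.stalk u ⟶ .of W := CommRingCat.ofHom (φ.hom.codRestrict _ hW)
  refine ⟨W, Spec.map θ ≫ X.fromSpecStalk u, ?_, ?_⟩
  · rw [← Spec.map_comp_assoc]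
    have : θ ≫ CommRingCat.ofHom (algebraMap W K) = φ := rfl
    rw [this]
    simp only [φ, Spec.map_comp, Category.assoc, Scheme.SpecMap_stalkSpecializes_fromSpecStalk]
    exact Scheme.Spec_stalkClosedPointTo_fromSpecStalk _
  · change X.fromSpecStalk u (Spec.map θ (IsLocalRing.closedPoint W)) = u
    have : Spec.map θ (IsLocalRing.closedPoint W) = IsLocalRing.closedPoint (X.presheaf.stalk u) :=
      IsLocalRing.comap_closedPoint (S := W) (φ.hom.codRestrict W.toSubring hW)
    rw [this, X.fromSpecStalk_closedPoint]

lemma Cen.lc [LocallyOfFiniteType f] (hξ : ξ ≫ f = Spec.map (CommRingCat.ofHom (algebraMap A K)))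
    {W : ValuationSubring K} {x : X} (hx : Cen ξ W x) {O : X.Opens} (hO : IsAffineOpen O)
    (hxO : x ∈ O) : ∃ S : Finset K, (∀ s ∈ S, s ∈ W) ∧ ∀ W' : ValuationSubring K,
      (∀ a, algebraMap A K a ∈ W') → (∀ s ∈ S, s ∈ W') → ∃ y ∈ O, Cen ξ W' y := by
  classical
  obtain ⟨l, hl, rfl⟩ := hx
  have hr : Set.range l ⊆ O := by
    rintro _ ⟨p, rfl⟩
    exact ((IsLocalRing.specializes_closedPoint p).map l.continuous).mem_open O.2 hxO
  obtain ⟨m, hm⟩ : ∃ m : Spec (CommRingCat.of W) ⟶ Spec Γ(X, O), m ≫ hO.fromSpec = l := by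
    refine ⟨IsOpenImmersion.lift hO.fromSpec l (by rw [hO.range_fromSpec]; exact hr), ?_⟩
    exact IsOpenImmersion.lift_fac _ _ _
  obtain ⟨θ, rfl⟩ := Spec.map_surjective m
  obtain ⟨ρ, hρ⟩ := Spec.map_surjective (hO.fromSpec ≫ f)
  have hft : ρ.hom.FiniteType := by
    have : LocallyOfFiniteType (Spec.map ρ) := by rw [hρ]; infer_instance
    rwa [HasRingHomProperty.Spec_iff (P := @LocallyOfFiniteType)] at this
  have hcomp : ∀ a, ((θ.hom (ρ.hom a) : W) : K) = algebraMap A K a := by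
    have : Spec.map (ρ ≫ θ ≫ CommRingCat.ofHom (algebraMap W K)) =
        Spec.map (CommRingCat.ofHom (algebraMap A K)) := by
      rw [← hξ, ← hl, ← hm]
      simp [Spec.map_comp, hρ]
    intro a
    exact congrArg (fun g => g.hom a) (Spec.map_injective this)
  let _ := ρ.hom.toAlgebra
  obtain ⟨T, hT⟩ : ∃ T : Finset Γ(X, O), Algebra.adjoin A (T : Set Γ(X, O)) = ⊤ := hft.1
  refine ⟨T.image fun t => ((θ.hom t : W) : K), ?_, fun W' hA hS => ?_⟩
  · intro s hs
    obtain ⟨t, -, rfl⟩ := Finset.mem_image.1 hs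
    exact (θ.hom t).2
  have hall : ∀ t : Γ(X, O), ((θ.hom t : W) : K) ∈ W' := by
    intro t
    have ht : t ∈ Algebra.adjoin A (T : Set Γ(X, O)) := by rw [hT]; trivial
    induction ht using Algebra.adjoin_induction with
    | mem t ht => exact hS _ (Finset.mem_image_of_mem _ ht)
    | algebraMap a => exact (hcomp a).symm ▸ hA a
    | add a b _ _ ha hb => rw [map_add]; exact add_mem ha hb
    | mul a b _ _ ha hb => rw [map_mul]; exact mul_mem ha hb
  let θ' : Γ(X, O) ⟶ CommRingCat.of W' := CommRingCat.ofHom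
    (((algebraMap W K).comp θ.hom).codRestrict W'.toSubring hall)
  refine ⟨_, ?_, Spec.map θ' ≫ hO.fromSpec, ?_, rfl⟩
  · have : (Spec.map θ' ≫ hO.fromSpec) (IsLocalRing.closedPoint W') ∈ Set.range hO.fromSpec :=
      ⟨Spec.map θ' (IsLocalRing.closedPoint W'), rfl⟩
    rwa [hO.range_fromSpec] at this
  · rw [← hl, ← hm, ← Spec.map_comp_assoc, ← Spec.map_comp_assoc]
    rfl

end Sch

theorem disj {A : Type u} [CommRing A] (I : Ideal A) [HenselianRing A I] {X : Scheme.{u}}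
    (f : X ⟶ Spec (CommRingCat.of A)) [IsProper f] {U₀ V₀ : Set X} (hU : IsClosed U₀)
    (hV : IsClosed V₀) (hd : Disjoint U₀ V₀)
    (hUV : ∀ x, x ∈ U₀ ∪ V₀ ↔ I ≤ (f x).asIdeal) {x u v : X} (hu : u ∈ U₀) (hv : v ∈ V₀)
    (hxu : x ⤳ u) (hxv : x ⤳ v) : False := by
  let K := AlgebraicClosure (X.residueField x)
  let ξ : Spec (CommRingCat.of K) ⟶ X :=
    Spec.map (CommRingCat.ofHom (algebraMap (X.residueField x) K)) ≫ X.fromSpecResidueField x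
  have hx : ξ (IsLocalRing.closedPoint K) = x := by
    exact Scheme.fromSpecResidueField_apply x _
  obtain ⟨φ, hφ⟩ := Spec.map_surjective (ξ ≫ f)
  let _ : Algebra A K := φ.hom.toAlgebra
  have hξ : ξ ≫ f = Spec.map (CommRingCat.ofHom (algebraMap A K)) := hφ.symm
  obtain ⟨W, hW⟩ := Cen.exists_of_specializes (ξ := ξ) (hx.symm ▸ hxu)
  obtain ⟨W', hW'⟩ := Cen.exists_of_specializes (ξ := ξ) (hx.symm ▸ hxv)
  have key : ∀ {W : ValuationSubring K} {y : X}, Cen ξ W y → y ∈ U₀ ∪ V₀ →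
      W ∈ RZ (algebraMap A K).range (algebraMap A K '' I) := by
    intro W y hy hyT
    obtain ⟨h1, h2⟩ := Cen.mem hξ hy
    refine ⟨?_, ?_⟩
    · rintro _ ⟨a, rfl⟩; exact h1 a
    · rintro _ ⟨a, ha, rfl⟩; exact (h2 a).1 ((hUV y).1 hyT ha)
  have key2 : ∀ {W : ValuationSubring K} {y : X}, Cen ξ W y →
      W ∈ RZ (algebraMap A K).range (algebraMap A K '' I) → y ∈ U₀ ∪ V₀ := by
    intro W y hy hWZ
    obtain ⟨h1, h2⟩ := Cen.mem hξ hy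
    rw [hUV]
    intro a ha
    exact (h2 a).2 (hWZ.2 _ ⟨a, ha, rfl⟩)
  have hLC : LC (RZ (algebraMap A K).range (algebraMap A K '' I)) (fun W => ∃ y ∈ U₀, Cen ξ W y) := by
    intro W hW
    have hA : ∀ {W}, W ∈ RZ (algebraMap A K).range (algebraMap A K '' I) →
      ∀ a, algebraMap A K a ∈ W := fun hW a => hW.1 _ ⟨a, rfl⟩
    obtain ⟨y, hy⟩ := Cen.exists hξ (hA hW)
    rcases key2 hy hW with hyU | hyV
    · have hyV : y ∈ (⟨V₀ᶜ, hV.isOpen_compl⟩ : X.Opens) := fun h => Set.disjoint_left.1 hd hyU h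
      obtain ⟨O, hO, hyO, hOV⟩ := exists_isAffineOpen_mem_and_subset hyV
      obtain ⟨S, hS1, hS2⟩ := Cen.lc hξ hy hO hyO
      refine ⟨S, hS1, fun W' hW' hS => ?_⟩
      obtain ⟨z, hzO, hz⟩ := hS2 W' (hA hW') hS
      have hzU : z ∈ U₀ := (key2 hz hW').resolve_right (hOV hzO)
      exact ⟨fun _ => ⟨y, hyU, hy⟩, fun _ => ⟨z, hzU, hz⟩⟩
    · have hyU : y ∈ (⟨U₀ᶜ, hU.isOpen_compl⟩ : X.Opens) := fun h => Set.disjoint_left.1 hd h hyV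
      obtain ⟨O, hO, hyO, hOV⟩ := exists_isAffineOpen_mem_and_subset hyU
      obtain ⟨S, hS1, hS2⟩ := Cen.lc hξ hy hO hyO
      refine ⟨S, hS1, fun W' hW' hS => ?_⟩
      obtain ⟨z, hzO, hz⟩ := hS2 W' (hA hW') hS
      constructor
      · rintro ⟨t, htU, ht⟩
        rw [Cen.unique hξ ht hz] at htU
        exact absurd htU (hOV hzO)
      · rintro ⟨t, htU, ht⟩
        rw [Cen.unique hξ ht hy] at htU
        exact absurd htU hyU
  obtain ⟨t, htU, ht⟩ := noSep I _ hLC (key hW (Or.inl hu)) (key hW' (Or.inr hv)) ⟨u, hu, hW⟩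
  rw [Cen.unique hξ ht hW'] at htU
  exact Set.disjoint_left.1 hd htU hv

end HensConn

namespace HensConn

section Topo
variable {X : Type u} [TopologicalSpace X] [CompactSpace X] [QuasiSober X]
    [PrespectralSpace X] [QuasiSeparatedSpace X]

lemma gen_closure {V₀ : Set X} (hV : IsClosed V₀) {u : X}
    (hu : u ∈ closure {x | ∃ v ∈ V₀, x ⤳ v}) : ∃ x, x ⤳ u ∧ ∃ v ∈ V₀, x ⤳ v := by
  let ι := {p : Set X × Set X // (IsOpen p.1 ∧ IsCompact p.1 ∧ u ∈ p.1) ∧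
    (IsOpen p.2 ∧ IsCompact p.2 ∧ V₀ ⊆ p.2)}
  let t : ι → Set (WithConstructibleTopology X) := fun i =>
    WithTopology.ofTopology ⁻¹' (i.1.1 ∩ i.1.2)
  have hι : Nonempty ι :=
    ⟨⟨(Set.univ, Set.univ), ⟨isOpen_univ, isCompact_univ, trivial⟩,
      isOpen_univ, isCompact_univ, Set.subset_univ _⟩⟩
  have hcl : ∀ i, IsClosed (t i) := by
    rintro ⟨⟨O, N⟩, ⟨h1, h2, h3⟩, h4, h5, h6⟩
    rw [WithConstructibleTopology.isClosed_iff]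
    have h7 : IsCompact (O ∩ N) := QuasiSeparatedSpace.inter_isCompact _ _ h1 h2 h4 h5
    have : @IsOpen X (constructibleTopology X) (O ∩ N)ᶜ :=
      IsCompact.isOpen_constructibleTopology_of_isClosed (by rwa [compl_compl])
        (h1.inter h4).isClosed_compl
    exact @IsClosed.mk _ (constructibleTopology X) _ this
  have hne : (⋂ i, t i).Nonempty := by
    apply IsCompact.nonempty_iInter_of_directed_nonempty_isCompact_isClosed
    · rintro ⟨⟨O, N⟩, ⟨h1, h2, h3⟩, h4, h5, h6⟩ ⟨⟨O', N'⟩, ⟨h1', h2', h3'⟩, h4', h5', h6'⟩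
      refine ⟨⟨(O ∩ O', N ∩ N'), ⟨h1.inter h1', QuasiSeparatedSpace.inter_isCompact _ _ h1 h2 h1' h2', h3, h3'⟩,
        h4.inter h4', QuasiSeparatedSpace.inter_isCompact _ _ h4 h5 h4' h5', Set.subset_inter h6 h6'⟩, ?_, ?_⟩
      · rintro x ⟨hx1, hx2⟩; exact ⟨hx1.1, hx2.1⟩
      · rintro x ⟨hx1, hx2⟩; exact ⟨hx1.2, hx2.2⟩
    · rintro ⟨⟨O, N⟩, ⟨h1, h2, h3⟩, h4, h5, h6⟩
      obtain ⟨x, hxO, v, hv, hxv⟩ := mem_closure_iff.1 hu O h1 h3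
      exact ⟨WithTopology.toTopology _ x, hxO, hxv.mem_open h4 (h6 hv)⟩
    · exact fun i => (hcl i).isCompact
    · exact hcl
  obtain ⟨y, hy⟩ := hne
  rw [Set.mem_iInter] at hy
  refine ⟨WithTopology.ofTopology y, ?_, ?_⟩
  · rw [specializes_iff_forall_open]
    intro s hs hus
    obtain ⟨O, ⟨hO1, hO2⟩, huO, hOs⟩ :=
      PrespectralSpace.isTopologicalBasis.exists_subset_of_mem_open hus hs
    exact hOs (hy ⟨(O, Set.univ), ⟨hO1, hO2, huO⟩,
      isOpen_univ, isCompact_univ, Set.subset_univ _⟩).1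
  · by_contra hno
    push Not at hno
    obtain ⟨N, hN1, hN2, hN3, hN4⟩ := PrespectralSpace.exists_isCompact_and_isOpen_between
      hV.isCompact (isClosed_closure (s := {WithTopology.ofTopology y})).isOpen_compl
      (fun v hv h => hno v hv (specializes_iff_mem_closure.2 h))
    have := (hy ⟨(Set.univ, N), ⟨isOpen_univ, isCompact_univ, trivial⟩,
      hN2, hN1, hN3⟩).2
    exact hN4 this (subset_closure rfl)

lemma topo {T : Set X} (hT : IsClosed T) (hmeet : ∀ C : Set X, IsClosed C → C.Nonempty → (C ∩ T).Nonempty)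
    (hdisj : ∀ U₀ V₀ : Set X, IsClosed U₀ → IsClosed V₀ → Disjoint U₀ V₀ → U₀ ∪ V₀ = T →
      ∀ x u v, u ∈ U₀ → v ∈ V₀ → x ⤳ u → x ⤳ v → False) :
    ConnectedSpace X ↔ _root_.IsConnected T := by
  constructor
  · intro h
    refine ⟨?_, ?_⟩
    · obtain ⟨x⟩ := h.toNonempty
      simpa using hmeet Set.univ isClosed_univ ⟨x, trivial⟩
    · rw [isPreconnected_closed_iff]
      intro U' V' hU' hV' hTUV hU'n hV'n
      by_contra hne
      rw [Set.not_nonempty_iff_eq_empty] at hne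
      have hd : Disjoint (T ∩ U') (T ∩ V') := by
        rw [Set.disjoint_left]
        intro x hx hx'
        have : x ∈ T ∩ (U' ∩ V') := ⟨hx.1, hx.2, hx'.2⟩
        rw [hne] at this; exact this
      have hun : (T ∩ U') ∪ (T ∩ V') = T := by
        rw [← Set.inter_union_distrib_left]; exact Set.inter_eq_left.2 hTUV
      have hUc := hT.inter hU'
      have hVc := hT.inter hV'
      generalize T ∩ U' = U₀ at *
      generalize T ∩ V' = V₀ at *
      have D := hdisj U₀ V₀ hUc hVc hd hun
      have cover : ∀ x, (∃ v ∈ U₀, x ⤳ v) ∨ (∃ v ∈ V₀, x ⤳ v) := by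
        intro x
        obtain ⟨y, hy, hyT⟩ := hmeet (closure {x}) isClosed_closure ⟨x, subset_closure rfl⟩
        rw [← hun] at hyT
        rw [← specializes_iff_mem_closure] at hy
        exact hyT.imp (fun h => ⟨y, h, hy⟩) (fun h => ⟨y, h, hy⟩)
      have c1 : IsClosed {x | ∃ v ∈ U₀, x ⤳ v} := by
        refine isClosed_of_closure_subset fun x hx => ?_
        refine (cover x).resolve_right ?_
        rintro ⟨v, hv, hxv⟩
        obtain ⟨y, hyx, u, hu, hyu⟩ := gen_closure hUc hx
        exact D y u v hu hv hyu (hyx.trans hxv)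
      have c2 : IsClosed {x | ∃ v ∈ V₀, x ⤳ v} := by
        refine isClosed_of_closure_subset fun x hx => ?_
        refine (cover x).resolve_left ?_
        rintro ⟨v, hv, hxv⟩
        obtain ⟨y, hyx, u, hu, hyu⟩ := gen_closure hVc hx
        exact D y v u hv hu (hyx.trans hxv) hyu
      have hp : IsPreconnected (Set.univ : Set X) := isPreconnected_univ
      rw [isPreconnected_closed_iff] at hp
      obtain ⟨u, hu⟩ := hU'n
      obtain ⟨v, hv⟩ := hV'n
      obtain ⟨x, -, ⟨u, hu, hxu⟩, v, hv, hxv⟩ := hp _ _ c1 c2 (fun x _ => cover x)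
        ⟨u, trivial, u, hu, specializes_rfl⟩ ⟨v, trivial, v, hv, specializes_rfl⟩
      exact D x u v hu hv hxu hxv
  · intro h
    have h2 : IsPreconnected (Set.univ : Set X) := by
      have h3 := h.2
      rw [isPreconnected_closed_iff] at h3 ⊢
      intro U V hU hV hUV hUn hVn
      rw [Set.univ_inter] at hUn hVn ⊢
      obtain ⟨x, -, hx⟩ := h3 U V hU hV (fun x _ => hUV trivial)
        (by rw [Set.inter_comm]; exact hmeet U hU hUn) (by rw [Set.inter_comm]; exact hmeet V hV hVn)
      exact ⟨x, hx⟩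
    exact { isPreconnected_univ := h2, toNonempty := ⟨h.1.some⟩ }

end Topo

end HensConn

/-- **Lemma 2.6**: if `(A, I)` is a henselian pair, `S = Spec A`, `S₀ = Spec (A/I)`,
`f : X ⟶ S` is proper and of finite presentation, and `X₀ = X ×_S S₀`, then `X` is nonempty
and connected if and only if `X₀` is nonempty and connected. -/
theorem connectedSpace_iff_of_henselian_pair
    (A : Type u) [CommRing A] (I : Ideal A) [HenselianRing A I]
    (X : Scheme.{u}) (f : X ⟶ Spec (CommRingCat.of A))
    [IsProper f] [LocallyOfFinitePresentation f] :
    ConnectedSpace X ↔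
      ConnectedSpace
        (pullback f (Spec.map (CommRingCat.ofHom (Ideal.Quotient.mk I))) : Scheme.{u}) := by
  have hr : Set.range (pullback.fst f (Spec.map (CommRingCat.ofHom (Ideal.Quotient.mk I)))) =
      {x | I ≤ (f x).asIdeal} := by
    rw [Scheme.Pullback.range_fst]
    have : Set.range (Spec.map (CommRingCat.ofHom (Ideal.Quotient.mk I))) =
        PrimeSpectrum.zeroLocus (I : Set A) := by
      have h := _root_.range_comap_of_surjective (A ⧸ I) (Ideal.Quotient.mk I)
        Ideal.Quotient.mk_surjective
      rw [Ideal.mk_ker] at h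
      exact h
    rw [this]
    rfl
  have hci : IsClosedImmersion (Spec.map (CommRingCat.ofHom (Ideal.Quotient.mk I))) :=
    IsClosedImmersion.spec_of_surjective _ Ideal.Quotient.mk_surjective
  have hemb := (pullback.fst f
    (Spec.map (CommRingCat.ofHom (Ideal.Quotient.mk I)))).isClosedEmbedding
  have hT := hemb.isClosed_range
  have e1 : ConnectedSpace
      (pullback f (Spec.map (CommRingCat.ofHom (Ideal.Quotient.mk I))) : Scheme.{u}) ↔
      _root_.IsConnected {x : X | I ≤ (f x).asIdeal} := by
    rw [← hr, ← Set.image_univ, connectedSpace_iff_univ]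
    unfold _root_.IsConnected
    rw [hemb.isInducing.isPreconnected_image, Set.image_nonempty]
  rw [hr] at hT
  rw [e1]
  have : CompactSpace X := by
    have : QuasiCompact f := inferInstance
    exact QuasiCompact.compactSpace_of_compactSpace f
  have : QuasiSeparatedSpace X :=
    quasiSeparatedSpace_of_quasiSeparated f
  refine HensConn.topo hT ?_ ?_
  · rintro C hC ⟨x, hx⟩
    have hfC : IsClosed (f '' C) := f.isClosedMap _ hC
    obtain ⟨m, hm, hxm⟩ := Ideal.exists_le_maximal (f x).asIdeal (f x).2.ne_top
    have hs : f x ⤳ (⟨m, hm.isPrime⟩ : PrimeSpectrum A) :=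
      (PrimeSpectrum.le_iff_specializes _ _).1 hxm
    obtain ⟨y, hy, hfy⟩ := hs.mem_closed hfC ⟨x, hx, rfl⟩
    refine ⟨y, hy, ?_⟩
    change I ≤ (f y).asIdeal
    rw [hfy]
    refine (HenselianRing.jac (I := I)).trans ?_
    exact sInf_le ⟨bot_le, hm⟩
  · intro U₀ V₀ hU hV hd hUV x u v hu hv hxu hxv
    exact HensConn.disj I f hU hV hd (fun y => by rw [hUV]; rfl) hu hv hxu hxv
end

section
/- Let A be a commutative ring and I ⊆ A an ideal contained in the Jacobson radical of A. Let f : X → Spec(A) be a proper morphism and let X₀ = X ×_{Spec(A)} Spec(A/I). Then every nonempty clopen subset of X has nonempty intersection with X₀; in particular, if X is nonempty then X₀ is nonempty, and if X is disconnected then X₀ is disconnected. -/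
open CategoryTheory AlgebraicGeometry MorphismProperty Limits

universe u

/-- If `I` is contained in the Jacobson radical of `A` and `f : X ⟶ Spec A` is proper, then
every nonempty clopen subset of `X` meets `X₀ = f⁻¹(V(I))`; in particular, if `X` is nonempty
then `X₀` is nonempty, and if `X` is (nonempty and) disconnected then `X₀` is disconnected. -/
theorem clopen_inter_nonempty_of_le_jacobson
    (A : Type u) [CommRing A] (I : Ideal A) (hI : I ≤ (⊥ : Ideal A).jacobson)
    (X : Scheme.{u}) (f : X ⟶ Spec (CommRingCat.of A)) [IsProper f] :
    (∀ U : Set X, IsClopen U → U.Nonempty →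
        (U ∩ f.base ⁻¹' PrimeSpectrum.zeroLocus (I : Set A)).Nonempty) ∧
      (Nonempty X → (f.base ⁻¹' PrimeSpectrum.zeroLocus (I : Set A)).Nonempty) ∧
      (Nonempty X → ¬ ConnectedSpace X →
        ¬ ConnectedSpace (f.base ⁻¹' PrimeSpectrum.zeroLocus (I : Set A))) := by
  have key : ∀ U : Set X, IsClosed U → U.Nonempty →
      (U ∩ f.base ⁻¹' PrimeSpectrum.zeroLocus (I : Set A)).Nonempty := by
    rintro U hU ⟨x, hx⟩
    have hcl : IsClosed (f.base '' U) := f.isClosedMap _ hU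
    let p : PrimeSpectrum A := f.base x
    obtain ⟨m, hm, hpm⟩ := Ideal.exists_le_maximal p.asIdeal p.isPrime.ne_top
    let q : PrimeSpectrum A := ⟨m, hm.isPrime⟩
    have hpq : p ⤳ q := (PrimeSpectrum.le_iff_specializes p q).mp hpm
    have hq : q ∈ f.base '' U := hpq.mem_closed hcl ⟨x, hx, rfl⟩
    obtain ⟨y, hy, hyq⟩ := hq
    refine ⟨y, hy, ?_⟩
    change f.base y ∈ PrimeSpectrum.zeroLocus (I : Set A)
    rw [hyq]
    have hIm : I ≤ m := hI.trans (sInf_le ⟨bot_le, hm⟩)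
    exact hIm
  refine ⟨fun U hU => key U hU.isClosed, fun h => ?_, fun h hX hc => hX ?_⟩
  · obtain ⟨y, -, hy⟩ := key Set.univ isClosed_univ Set.univ_nonempty
    exact ⟨y, hy⟩
  · have : PreconnectedSpace X := by
      rw [preconnectedSpace_iff_clopen]
      intro U hU
      by_contra! hne
      obtain ⟨h1, h2⟩ := hne
      obtain ⟨y, hyU, hy⟩ := key U hU.isClosed (by simpa [Set.nonempty_iff_ne_empty] using h1)
      obtain ⟨z, hzU, hz⟩ := key Uᶜ hU.compl.isClosed (Set.nonempty_compl.mpr h2)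
      have hV : IsClopen ((Subtype.val : (f.base ⁻¹' PrimeSpectrum.zeroLocus (I : Set A) : Set X) → X) ⁻¹' U) :=
        hU.preimage continuous_subtype_val
      rcases isClopen_iff.mp hV with h0 | h0
      · have : (⟨y, hy⟩ : (f.base ⁻¹' PrimeSpectrum.zeroLocus (I : Set A) : Set X)) ∈
          (∅ : Set _) := h0 ▸ hyU
        exact this
      · have : (⟨z, hz⟩ : (f.base ⁻¹' PrimeSpectrum.zeroLocus (I : Set A) : Set X)) ∈
          Subtype.val ⁻¹' U := h0 ▸ Set.mem_univ _
        exact hzU this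
    exact { toNonempty := h }
end
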